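/- arXiv:1805.09671 — 10 statements merged into one kernel-verified Lean document; each statement's English description precedes it below -/
import Mathlib

section
/- Let R be an order in an étale ℚ-algebra K. A fractional R-ideal S satisfies S·S = S if and only if S is an over-order of R, i.e. a subring of K containing R. In other words, the over-orders of R are precisely the idempotent elements of the monoid of fractional R-ideals under ideal multiplication. -/
/-!
Setting: `K` is an étale `ℚ`-algebra (a commutative `ℚ`-algebra, reduced and
finite-dimensional over `ℚ`), and `R` is an order in `K`: a subring of `K`
(equivalently a `ℤ`-subalgebra) that is finitely generated as a `ℤ`-module and
spans `K` over `ℚ`.  A fractional `R`-ideal is a finitely generated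
`R`-submodule of `K` spanning `K` over `ℚ`.
-/

open Submodule

variable {K : Type*} [CommRing K] [Algebra ℚ K]
variable {R : Subalgebra ℤ K}

/-- The ideal quotient `(I : J) = {x ∈ K | x·J ⊆ I}`. -/
def colonSub (I J : Submodule ↥R K) : Submodule ↥R K where
  carrier := {x : K | ∀ y ∈ J, x * y ∈ I}
  zero_mem' := fun y _ => by simp [I.zero_mem]
  add_mem' := fun {a b} ha hb y hy => by
    simpa [add_mul] using I.add_mem (ha y hy) (hb y hy)
  smul_mem' := fun c x hx y hy => by
    simpa [smul_mul_assoc] using I.smul_mem c (hx y hy)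

/-- Let `R` be an order in an étale `ℚ`-algebra `K`.  A fractional
`R`-ideal `S` satisfies `S·S = S` if and only if `S` is an over-order of `R`, i.e.
a subring of `K` containing `R`.  (Over-orders of `R` are precisely the idempotent
fractional `R`-ideals.) -/
theorem overorders_eq_idempotent_fractional_ideals
    [FiniteDimensional ℚ K] [IsReduced K]
    (hRfin : Module.Finite ℤ R) (hRspan : Submodule.span ℚ (R : Set K) = ⊤)
    (S : Submodule ↥R K) (hSfg : S.FG) (hSspan : Submodule.span ℚ (S : Set K) = ⊤) :
    S * S = S ↔
      ((1 : K) ∈ S ∧ (∀ x ∈ S, ∀ y ∈ S, x * y ∈ S) ∧ (R : Set K) ⊆ (S : Set K)) := by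
  constructor
  · intro h
    have hmul : ∀ x ∈ S, ∀ y ∈ S, x * y ∈ S := fun x hx y hy => by
      have := Submodule.mul_mem_mul hx hy
      rwa [h] at this
    have h1 : (1 : K) ∈ S := by
      let A : Subalgebra R K :=
        { carrier := {x | ∀ y ∈ S, x * y ∈ S}
          mul_mem' := fun {a b} ha hb y hy => by
            rw [mul_assoc]; exact ha _ (hb y hy)
          add_mem' := fun {a b} ha hb y hy => by
            rw [add_mul]; exact S.add_mem (ha y hy) (hb y hy)
          algebraMap_mem' := fun r y hy => by
            rw [← Algebra.smul_def]; exact S.smul_mem r hy }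
      let N : Submodule A K :=
        { carrier := S
          zero_mem' := S.zero_mem
          add_mem' := S.add_mem
          smul_mem' := fun c x hx => c.2 x hx }
      let I : Ideal A :=
        { carrier := {x | (x : K) ∈ S}
          zero_mem' := S.zero_mem
          add_mem' := S.add_mem
          smul_mem' := fun c x hx => c.2 x hx }
      have hN : N.FG := by
        obtain ⟨t, ht⟩ := hSfg
        refine ⟨t, le_antisymm ?_ ?_⟩
        · rw [Submodule.span_le]
          intro x hx
          change x ∈ S
          rw [← ht]
          exact Submodule.subset_span hx
        · intro x hx
          change x ∈ S at hx
          rw [← ht] at hx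
          exact Submodule.span_subset_span R A _ hx
      have hle : N ≤ I • N := by
        intro x hx
        change x ∈ S at hx
        rw [← h] at hx
        refine Submodule.mul_induction_on hx ?_ ?_
        · intro m hm n hn
          exact Submodule.smul_mem_smul (r := (⟨m, fun y hy => hmul m hm y hy⟩ : A))
            (I := I) (N := N) hm hn
        · intro a b ha hb
          exact Submodule.add_mem _ ha hb
      obtain ⟨r, hr, hr0⟩ :=
        Submodule.exists_sub_one_mem_and_smul_eq_zero_of_fg_of_le_smul I N hN hle
      have hker : (⊤ : Submodule ℚ K) ≤ LinearMap.ker (LinearMap.mulLeft ℚ (r : K)) := by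
        rw [← hSspan, Submodule.span_le]
        intro x hx
        exact hr0 x hx
      have hz : (r : K) = 0 := by
        have : (r : K) * 1 = 0 := hker (Submodule.mem_top (x := (1 : K)))
        simpa using this
      have h2 : (r : K) - 1 ∈ S := hr
      rw [hz, zero_sub] at h2
      simpa using S.neg_mem h2
    refine ⟨h1, hmul, fun x hx => ?_⟩
    have := S.smul_mem (⟨x, hx⟩ : R) h1
    simpa [Subalgebra.smul_def] using this
  · rintro ⟨h1, hmul, -⟩
    apply le_antisymm
    · exact Submodule.mul_le.2 hmul
    · intro x hx
      simpa using Submodule.mul_mem_mul hx h1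
end

section
/- Let R be an order in an étale ℚ-algebra K, let I be a fractional R-ideal and let S be an over-order of R. Then S = (I:I) if and only if I·I^t = S^t, where I^t denotes the trace dual of I. -/
/-!
Setting: `K` is an étale `ℚ`-algebra (a commutative `ℚ`-algebra, reduced and
finite-dimensional over `ℚ`), and `R` is an order in `K`: a subring of `K`
(equivalently a `ℤ`-subalgebra) that is finitely generated as a `ℤ`-module and
spans `K` over `ℚ`.  A fractional `R`-ideal is a finitely generated
`R`-submodule of `K` spanning `K` over `ℚ`.
-/

open Submodule

variable {K : Type*} [CommRing K] [Algebra ℚ K]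
variable {R : Subalgebra ℤ K}

/-- The trace dual `I^t = {x ∈ K | Tr_{K/ℚ}(x·I) ⊆ ℤ}`, where `Tr_{K/ℚ}(z)` is the
trace of the `ℚ`-linear endomorphism `y ↦ z·y` of `K`. -/
def traceDualSub (I : Submodule ↥R K) : Submodule ↥R K where
  carrier := {x : K | ∀ y ∈ I, ∃ n : ℤ, Algebra.trace ℚ K (x * y) = (n : ℚ)}
  zero_mem' := fun y _ => ⟨0, by simp⟩
  add_mem' := fun {a b} ha hb y hy => by
    obtain ⟨n, hn⟩ := ha y hy
    obtain ⟨m, hm⟩ := hb y hy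
    refine ⟨n + m, ?_⟩
    rw [add_mul, map_add, hn, hm]
    push_cast
    ring
  smul_mem' := fun c x hx y hy => by
    obtain ⟨n, hn⟩ := hx (c • y) (I.smul_mem c hy)
    refine ⟨n, ?_⟩
    rw [← hn]
    congr 1
    rw [Algebra.smul_def, Algebra.smul_def]
    ring

section Aux

open scoped Pointwise

theorem aux_nondeg (K : Type*) [CommRing K] [Algebra ℚ K] [FiniteDimensional ℚ K] [IsReduced K] :
    (Algebra.traceForm ℚ K).Nondegenerate := by
  refine (Algebra.traceForm_isSymm ℚ (S := K)).isRefl.nondegenerate_iff_separatingLeft.mpr ?_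
  intro x hx
  have : IsArtinianRing K := .of_finite ℚ K
  obtain ⟨n, y, hy⟩ := IsArtinian.exists_pow_succ_smul_dvd x (1 : K)
  have hxy : x * (1 - x * y) = 0 := by
    apply IsReduced.eq_zero
    refine ⟨n + 1, ?_⟩
    have h0 : x ^ n * (1 - x * y) = 0 := by
      simp only [smul_eq_mul, Nat.succ_eq_add_one] at hy
      linear_combination -hy
    rw [mul_pow, pow_succ, pow_succ]
    linear_combination (x * (1 - x * y) ^ n) * h0
  have he : IsIdempotentElem (x * y) := by
    unfold IsIdempotentElem
    linear_combination (-y) * hxy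
  have ht : Algebra.trace ℚ K (x * y) = 0 := by
    simpa [Algebra.traceForm_apply] using hx y
  rw [Algebra.trace_apply] at ht
  have he2 : IsIdempotentElem (LinearMap.mul ℚ K (x * y)) := he.map (Algebra.lmul ℚ K)
  have h3 := LinearMap.IsIdempotentElem.eq_zero_of_trace_eq_zero he2 ht
  have h4 : x * y = 0 := by simpa using LinearMap.congr_fun h3 1
  linear_combination hxy + x * h4

/-- lattice basis -/
theorem aux_basis {K : Type*} [CommRing K] [Algebra ℚ K] [FiniteDimensional ℚ K]
    (J : Submodule ℤ K) (hfg : J.FG) (hspan : Submodule.span ℚ (J : Set K) = ⊤) :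
    ∃ (n : ℕ) (b : Module.Basis (Fin n) ℚ K), J = Submodule.span ℤ (Set.range b) := by
  have : Submodule.IsLattice ℚ J := ⟨hfg, hspan⟩
  have := Submodule.IsLattice.free ℚ J
  let b := Module.finBasis ℤ J
  refine ⟨_, b.extendOfIsLattice ℚ, ?_⟩
  have h := congrArg (Submodule.map J.subtype) b.span_eq
  rw [Submodule.map_span, Submodule.map_top, Submodule.range_subtype, ← Set.range_comp] at h
  refine h.symm.trans ?_
  congr 2
  ext i
  simp

variable {K : Type*} [CommRing K] [Algebra ℚ K] {R : Subalgebra ℤ K}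

theorem aux_dual (J : Submodule ↥R K) :
    (traceDualSub J).restrictScalars ℤ =
      (Algebra.traceForm ℚ K).dualSubmodule (J.restrictScalars ℤ) := by
  ext x
  simp only [LinearMap.BilinForm.mem_dualSubmodule, Submodule.mem_one, Algebra.traceForm_apply,
    Submodule.restrictScalars_mem]
  change (∀ y ∈ J, ∃ n : ℤ, Algebra.trace ℚ K (x * y) = (n : ℚ)) ↔ _
  simp [eq_comm]

/-- lattice predicate -/
def AuxLat (J : Submodule ↥R K) : Prop :=
  (J.restrictScalars ℤ).FG ∧ Submodule.span ℚ (J : Set K) = ⊤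

theorem aux_fg (hR : Module.Finite ℤ R) (J : Submodule ↥R K) (h : J.FG) :
    (J.restrictScalars ℤ).FG := by
  have : Module.Finite R J := Module.Finite.iff_fg.mpr h
  have : Module.Finite ℤ J := Module.Finite.trans R J
  exact Module.Finite.iff_fg.mp (inferInstanceAs (Module.Finite ℤ J))

theorem aux_fg' (J : Submodule ↥R K) (h : (J.restrictScalars ℤ).FG) : J.FG := by
  have : Module.Finite ℤ J := Module.Finite.iff_fg.mpr h
  exact Module.Finite.iff_fg.mp (Module.Finite.of_restrictScalars_finite ℤ R J)

theorem aux_dd [FiniteDimensional ℚ K] [IsReduced K] (J : Submodule ↥R K) (h : AuxLat J) :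
    traceDualSub (traceDualSub J) = J := by
  apply Submodule.restrictScalars_injective ℤ
  obtain ⟨n, b, hb⟩ := aux_basis _ h.1 h.2
  rw [aux_dual, aux_dual, hb]
  exact LinearMap.BilinForm.dualSubmodule_dualSubmodule_of_basis _ (aux_nondeg K)
    (Algebra.traceForm_isSymm ℚ) b

theorem aux_dlat [FiniteDimensional ℚ K] [IsReduced K] (J : Submodule ↥R K) (h : AuxLat J) :
    AuxLat (traceDualSub J) := by
  obtain ⟨n, b, hb⟩ := aux_basis _ h.1 h.2
  have h1 := aux_dual J
  rw [hb, LinearMap.BilinForm.dualSubmodule_span_of_basis _ (aux_nondeg K)] at h1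
  constructor
  · rw [h1]
    exact Submodule.fg_span (Set.finite_range _)
  · have h2 : ((traceDualSub J : Submodule R K) : Set K) =
      ((traceDualSub J).restrictScalars ℤ : Submodule ℤ K) := rfl
    rw [h2, h1, Submodule.span_span_of_tower, Module.Basis.span_eq]

theorem aux_mul (hR : Module.Finite ℤ R) (I J : Submodule ↥R K) (hI : AuxLat I) (hJ : AuxLat J) :
    AuxLat (I * J) := by
  constructor
  · apply aux_fg hR
    exact Submodule.FG.mul (aux_fg' I hI.1) (aux_fg' J hJ.1)
  · rw [eq_top_iff]
    calc (⊤ : Submodule ℚ K) ≤ ⊤ * ⊤ := fun x _ => by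
          simpa using Submodule.mul_mem_mul (Submodule.mem_top (x := x) (R := ℚ))
            (Submodule.mem_top (x := (1 : K)) (R := ℚ))
      _ = Submodule.span ℚ ((I : Set K) * (J : Set K)) := by
          rw [← Submodule.span_mul_span, hI.2, hJ.2]
      _ ≤ _ := by
          apply Submodule.span_mono
          rintro _ ⟨a, ha, b, hb, rfl⟩
          exact Submodule.mul_mem_mul ha hb

theorem aux_colon [FiniteDimensional ℚ K] [IsReduced K] (I : Submodule ↥R K) (hI : AuxLat I) :
    traceDualSub (I * traceDualSub I) = colonSub I I := by
  ext x
  constructor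
  · intro hx y hy
    rw [← aux_dd I hI]
    intro z hz
    rw [mul_assoc]
    exact hx _ (Submodule.mul_mem_mul hy hz)
  · intro hx w hw
    induction hw using Submodule.mul_induction_on' with
    | mem_mul_mem m hm n hn =>
      obtain ⟨k, hk⟩ := hn _ (hx m hm)
      exact ⟨k, by rw [← hk]; congr 1; ring⟩
    | add a _ b _ ha hb =>
      obtain ⟨k, hk⟩ := ha
      obtain ⟨l, hl⟩ := hb
      exact ⟨k + l, by rw [mul_add, map_add, hk, hl]; push_cast; ring⟩

end Aux

/-- Let `R` be an order in an étale `ℚ`-algebra `K`, `I` a fractional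
`R`-ideal and `S` an over-order of `R` (an order with `R ⊆ S ⊆ K`, i.e. a fractional
`R`-ideal that is a subring of `K`).  Then `S = (I : I)` if and only if `I·I^t = S^t`. -/
theorem multiplicatorRing_eq_iff_mul_traceDual
    [FiniteDimensional ℚ K] [IsReduced K]
    (hRfin : Module.Finite ℤ R) (hRspan : Submodule.span ℚ (R : Set K) = ⊤)
    (I : Submodule ↥R K) (hIfg : I.FG) (hIspan : Submodule.span ℚ (I : Set K) = ⊤)
    (S : Submodule ↥R K) (hSfg : S.FG) (hSspan : Submodule.span ℚ (S : Set K) = ⊤)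
    (hSone : (1 : K) ∈ S) (hSmul : S * S ≤ S) :
    S = colonSub I I ↔ I * traceDualSub I = traceDualSub S := by
  have hI : AuxLat I := ⟨aux_fg hRfin I hIfg, hIspan⟩
  have hS : AuxLat S := ⟨aux_fg hRfin S hSfg, hSspan⟩
  constructor
  · intro h
    rw [h, ← aux_colon I hI, aux_dd _ (aux_mul hRfin _ _ hI (aux_dlat I hI))]
  · intro h
    rw [← aux_colon I hI, h, aux_dd S hS]
end

section
/- Let R be an order in an étale ℚ-algebra K and let I be a fractional R-ideal. Then I is invertible in R (i.e. I·(R:I) = R) if and only if for every maximal ideal 𝔭 of R the localization I_𝔭 is a principal R_𝔭-module, i.e. generated by a single element over R_𝔭. -/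
/-!
Setting: `K` is an étale `ℚ`-algebra (a commutative `ℚ`-algebra, reduced and
finite-dimensional over `ℚ`), and `R` is an order in `K`: a subring of `K`
(equivalently a `ℤ`-subalgebra) that is finitely generated as a `ℤ`-module and
spans `K` over `ℚ`.  A fractional `R`-ideal is a finitely generated
`R`-submodule of `K` spanning `K` over `ℚ`.
-/

open Submodule

variable {K : Type*} [CommRing K] [Algebra ℚ K]
variable {R : Subalgebra ℤ K}

theorem exists_nat_mem_aux (I : Submodule ↥R K)
    (hIspan : Submodule.span ℚ (I : Set K) = ⊤) :
    ∃ n : ℕ, n ≠ 0 ∧ (n : K) ∈ I := by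
  have key : ∀ x ∈ Submodule.span ℚ (I : Set K), ∃ n : ℕ, n ≠ 0 ∧ (n : K) * x ∈ I := by
    intro x hx
    induction hx using Submodule.span_induction with
    | mem x h => exact ⟨1, one_ne_zero, by simpa using h⟩
    | zero => exact ⟨1, one_ne_zero, by simp⟩
    | add x y _ _ hx hy =>
      obtain ⟨n, hn, hnx⟩ := hx
      obtain ⟨m, hm, hmy⟩ := hy
      refine ⟨n * m, mul_ne_zero hn hm, ?_⟩
      have h1 := I.nsmul_mem hnx m
      have h2 := I.nsmul_mem hmy n
      have h3 := I.add_mem h1 h2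
      convert h3 using 1
      simp only [nsmul_eq_mul]
      push_cast
      ring
    | smul q x _ hx =>
      obtain ⟨n, hn, hnx⟩ := hx
      refine ⟨n * q.den, mul_ne_zero hn q.den_nz, ?_⟩
      have h1 := zsmul_mem hnx q.num
      convert h1 using 1
      have h2 : (q.den : K) * algebraMap ℚ K q = (q.num : K) := by
        have := congrArg (algebraMap ℚ K) (Rat.den_mul_eq_num q)
        rwa [map_mul, map_natCast, map_intCast] at this
      rw [zsmul_eq_mul, Algebra.smul_def, ← h2]
      push_cast
      ring
  obtain ⟨n, hn, h⟩ := key 1 (by rw [hIspan]; trivial)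
  exact ⟨n, hn, by simpa using h⟩

/-- Let `R` be an order in an étale `ℚ`-algebra `K` and `I` a
fractional `R`-ideal.  Then `I` is invertible in `R` (i.e. `I·(R:I) = R`) if and only
if for every maximal ideal `𝔭` of `R` the localization `I_𝔭` is a principal
`R_𝔭`-module, i.e. generated by a single element over `R_𝔭`. -/
theorem invertible_iff_locally_principal
    [FiniteDimensional ℚ K] [IsReduced K]
    (hRfin : Module.Finite ℤ R) (hRspan : Submodule.span ℚ (R : Set K) = ⊤)
    (I : Submodule ↥R K) (hIfg : I.FG) (hIspan : Submodule.span ℚ (I : Set K) = ⊤) :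
    I * colonSub 1 I = 1 ↔
      ∀ (𝔭 : Ideal ↥R) [𝔭.IsMaximal],
        Submodule.IsPrincipal
          (⊤ : Submodule (Localization.AtPrime 𝔭) (LocalizedModule 𝔭.primeCompl ↥I)) := by
  constructor
  · intro h 𝔭 h𝔭
    have hex : ∃ a ∈ I, ∃ b ∈ colonSub 1 I, ∃ s : ↥R, s ∉ 𝔭 ∧ a * b = (s : K) := by
      by_contra hcon
      push Not at hcon
      have hle : I * colonSub 1 I ≤ Submodule.map (Algebra.linearMap ↥R K) 𝔭 := by
        rw [Submodule.mul_le]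
        intro a ha b hb
        obtain ⟨s, hs⟩ := Submodule.mem_one.1 (hb a ha)
        have hs' : a * b = (s : K) := by rw [mul_comm]; exact hs.symm
        refine ⟨s, ?_, hs'.symm⟩
        by_contra hsp
        exact hcon a ha b hb s hsp hs'
      rw [h] at hle
      obtain ⟨s, hs, hs1⟩ := hle (Submodule.mem_one.2 ⟨1, map_one _⟩)
      have : s = 1 := Subtype.ext hs1
      exact h𝔭.ne_top ((Ideal.eq_top_iff_one _).2 (this ▸ hs))
    obtain ⟨a, ha, b, hb, s, hs, hab⟩ := hex
    refine ⟨⟨LocalizedModule.mk ⟨a, ha⟩ 1, ?_⟩⟩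
    symm
    rw [eq_top_iff]
    rintro y -
    induction y using LocalizedModule.induction_on with
    | h x u =>
      obtain ⟨r, hr⟩ := Submodule.mem_one.1 (hb x x.2)
      refine Submodule.mem_span_singleton.2
        ⟨Localization.mk r (u * ⟨s, hs⟩), ?_⟩
      rw [LocalizedModule.mk_smul_mk, LocalizedModule.mk_eq]
      refine ⟨1, ?_⟩
      apply Subtype.ext
      have hr' : (r : K) = b * x := hr
      simp only [Submonoid.smul_def, Submodule.coe_smul, Algebra.smul_def, Subalgebra.algebraMap_def,
        one_smul, mul_one, OneMemClass.coe_one, Submonoid.coe_mul, MulMemClass.coe_mul, hr', ← hab]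
      simp
      ring
  · intro h
    have hle : I * colonSub 1 I ≤ 1 := by
      rw [Submodule.mul_le]
      intro a ha b hb
      rw [mul_comm]
      exact hb a ha
    refine le_antisymm hle ?_
    by_contra hnot
    let A : Ideal ↥R := Submodule.comap (Algebra.linearMap ↥R K) (I * colonSub 1 I)
    have hA : A ≠ ⊤ := by
      intro hA
      apply hnot
      rw [Submodule.one_le]
      have : (1 : ↥R) ∈ A := hA ▸ trivial
      simpa [A] using this
    obtain ⟨𝔭, h𝔭, hA𝔭⟩ := Ideal.exists_le_maximal A hA
    obtain ⟨⟨g, hg⟩⟩ := h 𝔭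
    obtain ⟨⟨a, ha⟩, u, rfl⟩ : ∃ a u, g = LocalizedModule.mk a u := by
      induction g using LocalizedModule.induction_on with
      | h x u => exact ⟨x, u, rfl⟩
    have hx : ∀ x ∈ I, ∃ t : ↥R, t ∉ 𝔭 ∧ ∃ r : ↥R, (t : K) * x = r * a := by
      intro x hx
      have h1 : (LocalizedModule.mk (⟨x, hx⟩ : ↥I) (1 : 𝔭.primeCompl)) ∈
          (⊤ : Submodule (Localization.AtPrime 𝔭) (LocalizedModule 𝔭.primeCompl ↥I)) := trivial
      rw [hg] at h1
      obtain ⟨c, hc⟩ := Submodule.mem_span_singleton.1 h1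
      induction c using Localization.induction_on with
      | H c =>
      obtain ⟨r, v⟩ := c
      rw [LocalizedModule.mk_smul_mk, LocalizedModule.mk_eq] at hc
      obtain ⟨w, hw⟩ := hc
      refine ⟨(w * (v * u) : 𝔭.primeCompl), (w * (v * u)).2, w * r, ?_⟩
      have := congrArg Subtype.val hw
      simp only [Submonoid.smul_def, Submodule.coe_smul, Algebra.smul_def,
        Subalgebra.algebraMap_def, one_smul, OneMemClass.coe_one, Submonoid.coe_mul,
        MulMemClass.coe_mul] at this
      simp at this ⊢
      linear_combination -this
    have hall : ∃ t : ↥R, t ∉ 𝔭 ∧ ∀ x ∈ I, ∃ r : ↥R, (t : K) * x = r * a := by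
      obtain ⟨S, hS⟩ := hIfg
      have hSI : ∀ x ∈ S, x ∈ I := fun x hx => hS ▸ Submodule.subset_span hx
      choose! T hT1 hT2 using hx
      refine ⟨∏ x ∈ S, T x, ?_, ?_⟩
      · have : (∏ x ∈ S, T x) ∈ 𝔭.primeCompl :=
          Submonoid.prod_mem _ fun x hx => hT1 x (hSI x hx)
        exact this
      · intro x hx
        rw [← hS] at hx
        induction hx using Submodule.span_induction with
        | mem x hxS =>
          obtain ⟨r, hr⟩ := hT2 x (hSI x hxS)
          classical
          rw [← Finset.mul_prod_erase S T hxS]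
          refine ⟨(∏ y ∈ S.erase x, T y) * r, ?_⟩
          rw [MulMemClass.coe_mul, MulMemClass.coe_mul]
          linear_combination ((∏ y ∈ S.erase x, T y : ↥R) : K) * hr
        | zero => exact ⟨0, by simp⟩
        | add x y _ _ hx hy =>
          obtain ⟨r, hr⟩ := hx
          obtain ⟨r', hr'⟩ := hy
          exact ⟨r + r', by rw [mul_add, hr, hr', AddMemClass.coe_add, add_mul]⟩
        | smul c x _ hx =>
          obtain ⟨r, hr⟩ := hx
          refine ⟨c * r, ?_⟩
          rw [Algebra.smul_def, Subalgebra.algebraMap_def, MulMemClass.coe_mul]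
          linear_combination (c : K) * hr
    obtain ⟨t, ht, hta⟩ := hall
    obtain ⟨n, hn, hnI⟩ := exists_nat_mem_aux I hIspan
    obtain ⟨r, hr⟩ := hta n hnI
    obtain ⟨q, hq⟩ : ∃ q : K, (n : K) * q = 1 := by
      refine ⟨algebraMap ℚ K (n : ℚ)⁻¹, ?_⟩
      rw [← map_natCast (algebraMap ℚ K), ← map_mul, mul_inv_cancel₀ (Nat.cast_ne_zero.2 hn),
        map_one]
    have hb : (t : K) * r * q ∈ colonSub 1 I := by
      intro x hx
      obtain ⟨r', hr'⟩ := hta x hx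
      refine Submodule.mem_one.2 ⟨r' * t, ?_⟩
      change ((r' * t : ↥R) : K) = _
      rw [MulMemClass.coe_mul]
      linear_combination (-(r : K) * q) * hr' + (r' : K) * q * hr - (r' : K) * t * hq
    have hmem : t * t ∈ A := by
      change ((t * t : ↥R) : K) ∈ I * colonSub 1 I
      have h2 := Submodule.mul_mem_mul ha hb
      convert h2 using 1
      rw [MulMemClass.coe_mul]
      linear_combination (t : K) * q * hr - (t : K) * t * hq
    exact (h𝔭.isPrime.mem_or_mem (hA𝔭 hmem)).elim ht ht
end

section
/- Let R be an order in an étale ℚ-algebra K and let 𝔭 be a maximal ideal of R. Then 𝔭 is invertible as a fractional R-ideal (i.e. 𝔭·(R:𝔭) = R) if and only if the localization R_𝔭 is a principal ideal ring. -/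
/-!
Setting: `K` is an étale `ℚ`-algebra (a commutative `ℚ`-algebra, reduced and
finite-dimensional over `ℚ`), and `R` is an order in `K`: a subring of `K`
(equivalently a `ℤ`-subalgebra) that is finitely generated as a `ℤ`-module and
spans `K` over `ℚ`.  A fractional `R`-ideal is a finitely generated
`R`-submodule of `K` spanning `K` over `ℚ`.
-/

open Submodule

variable {K : Type*} [CommRing K] [Algebra ℚ K]
variable {R : Subalgebra ℤ K}

/-- Let `R` be an order in an étale `ℚ`-algebra `K` and `𝔭` a maximal
ideal of `R`.  Then `𝔭` (viewed as a fractional `R`-ideal inside `K`) is invertible,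
i.e. `𝔭·(R:𝔭) = R`, if and only if the localization `R_𝔭` is a principal ideal ring. -/
theorem maximal_ideal_invertible_iff_localization_PIR
    [FiniteDimensional ℚ K] [IsReduced K]
    (hRfin : Module.Finite ℤ R) (hRspan : Submodule.span ℚ (R : Set K) = ⊤)
    (𝔭 : Ideal ↥R) [𝔭.IsMaximal] :
    (Submodule.map (Algebra.linearMap ↥R K) 𝔭) *
        colonSub 1 (Submodule.map (Algebra.linearMap ↥R K) 𝔭) = 1 ↔
      IsPrincipalIdealRing (Localization.AtPrime 𝔭) := by
  have hNoeth : IsNoetherianRing R := IsNoetherianRing.of_finite ℤ R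
  have hNA : IsNoetherianRing (Localization.AtPrime 𝔭) :=
    IsLocalization.isNoetherianRing 𝔭.primeCompl _ hNoeth
  constructor
  · intro h
    -- find the local generator
    obtain ⟨a, ha, x, hx, u, hu, hux⟩ : ∃ a ∈ 𝔭, ∃ x : K,
        (∀ y ∈ 𝔭, ∃ r : R, x * (y : K) = r) ∧ ∃ u : R, u ∉ 𝔭 ∧ (a : K) * x = u := by
      by_contra! hcon
      have hle : (Submodule.map (Algebra.linearMap ↥R K) 𝔭) *
          colonSub 1 (Submodule.map (Algebra.linearMap ↥R K) 𝔭) ≤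
          Submodule.map (Algebra.linearMap ↥R K) 𝔭 := by
        rw [Submodule.mul_le]
        rintro _ ⟨m, hm, rfl⟩ x hx
        have hx' : ∀ y ∈ 𝔭, ∃ r : R, x * (y : K) = r := by
          intro y hy
          obtain ⟨r, hr⟩ := Submodule.mem_one.1 (hx (y : K) ⟨y, hy, rfl⟩)
          exact ⟨r, hr.symm⟩
        obtain ⟨r, hr⟩ := hx' m hm
        have : r ∈ 𝔭 := by
          by_contra hr'
          exact hcon m hm x hx' r hr' (by rw [mul_comm]; exact hr)
        refine ⟨r, this, ?_⟩
        change (r : K) = (m : K) * x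
        rw [← hr, mul_comm]
      rw [h] at hle
      obtain ⟨y, hy, hy1⟩ := hle (Submodule.mem_one.2 ⟨1, map_one _⟩)
      have : y = 1 := Subtype.ext hy1
      exact (Ideal.ne_top_iff_one 𝔭).1 (Ideal.IsMaximal.ne_top inferInstance) (this ▸ hy)
    set α := algebraMap R (Localization.AtPrime 𝔭) a with hα
    have hm : IsLocalRing.maximalIdeal (Localization.AtPrime 𝔭) ≤ Ideal.span {α} := by
      rw [← Localization.AtPrime.map_eq_maximalIdeal, Ideal.map_le_iff_le_comap]
      intro y hy
      rw [Ideal.mem_comap, Ideal.mem_span_singleton]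
      obtain ⟨r, hr⟩ := hx y hy
      have e : u * y = a * r := by
        apply Subtype.ext
        change (u : K) * y = a * r
        rw [← hux, ← hr]; ring
      have hunit : IsUnit (algebraMap R (Localization.AtPrime 𝔭) u) :=
        IsLocalization.map_units (Localization.AtPrime 𝔭) (⟨u, hu⟩ : 𝔭.primeCompl)
      rw [← hunit.dvd_mul_left, ← map_mul, e, map_mul]
      exact dvd_mul_right _ _
    refine IsPrincipalIdealRing.of_prime fun q hq => ?_
    have hqm := IsLocalRing.le_maximalIdeal hq.ne_top
    by_cases haq : α ∈ q
    · refine ⟨⟨α, le_antisymm (hqm.trans hm) ?_⟩⟩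
      exact (Ideal.span_singleton_le_iff_mem _).2 haq
    · have hαm : α ∈ IsLocalRing.maximalIdeal (Localization.AtPrime 𝔭) := by
        rw [← Localization.AtPrime.map_eq_maximalIdeal]
        exact Ideal.mem_map_of_mem _ ha
      have : q = ⊥ := by
        refine Submodule.eq_bot_of_le_smul_of_le_jacobson_bot
          (IsLocalRing.maximalIdeal (Localization.AtPrime 𝔭)) q (IsNoetherian.noetherian q) ?_
          (IsLocalRing.maximalIdeal_le_jacobson _)
        intro z hz
        obtain ⟨w, rfl⟩ := Ideal.mem_span_singleton.1 (hm (hqm hz))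
        have hw := (hq.mem_or_mem hz).resolve_left haq
        exact Submodule.smul_mem_smul hαm hw
      rw [this]; infer_instance
  · intro h
    obtain ⟨g, hg⟩ := (IsPrincipalIdealRing.principal
      (IsLocalRing.maximalIdeal (Localization.AtPrime 𝔭))).principal
    obtain ⟨⟨a, t⟩, hgt⟩ := IsLocalization.surj 𝔭.primeCompl g
    have htu : IsUnit (algebraMap R (Localization.AtPrime 𝔭) t) :=
      IsLocalization.map_units (Localization.AtPrime 𝔭) t
    have ha : a ∈ 𝔭 := by
      rw [← IsLocalization.AtPrime.to_map_mem_maximal_iff (Localization.AtPrime 𝔭) 𝔭]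
      change algebraMap R (Localization.AtPrime 𝔭) a ∈ _
      rw [← hgt]
      apply Ideal.mul_mem_right
      rw [hg]
      exact Submodule.mem_span_singleton_self g
    have h1 : ∀ y ∈ 𝔭, ∃ s ∉ 𝔭, a ∣ s * y := by
      intro y hy
      have hym : algebraMap R (Localization.AtPrime 𝔭) y ∈
          IsLocalRing.maximalIdeal (Localization.AtPrime 𝔭) :=
        (IsLocalization.AtPrime.to_map_mem_maximal_iff _ 𝔭 y).2 hy
      rw [hg] at hym
      obtain ⟨c, hc⟩ := Ideal.mem_span_singleton.1 hym
      obtain ⟨⟨r, v⟩, hrv⟩ := IsLocalization.surj 𝔭.primeCompl c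
      have e : algebraMap R (Localization.AtPrime 𝔭) (y * (t * v)) =
          algebraMap R (Localization.AtPrime 𝔭) (a * r) := by
        simp only [map_mul] at *
        rw [hc, ← hgt, ← hrv]; ring
      obtain ⟨w, hw⟩ := (IsLocalization.eq_iff_exists 𝔭.primeCompl _).1 e
      refine ⟨w * (t * v), (w * (t * v)).2, w * r, ?_⟩
      push_cast
      linear_combination hw
    have h2 : ∃ s ∉ 𝔭, ∀ y ∈ 𝔭, a ∣ s * y := by
      obtain ⟨S, hS⟩ := (IsNoetherian.noetherian 𝔭 : 𝔭.FG)
      have hS' : ∀ y ∈ S, y ∈ 𝔭 := fun y hy => hS ▸ Submodule.subset_span hy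
      have h1' : ∀ y : R, ∃ s ∉ 𝔭, y ∈ 𝔭 → a ∣ s * y := fun y => by
        by_cases hy : y ∈ 𝔭
        · obtain ⟨s, hs, h⟩ := h1 y hy
          exact ⟨s, hs, fun _ => h⟩
        · exact ⟨y, hy, fun h => absurd h hy⟩
      choose f hf hf' using h1'
      refine ⟨∏ y ∈ S, f y, ?_, ?_⟩
      · exact prod_mem (S := 𝔭.primeCompl) (fun y _ => hf y)
      · intro y hy
        rw [← hS] at hy
        induction hy using Submodule.span_induction with
        | mem y hy =>
          exact (hf' y (hS' y hy)).trans
            (mul_dvd_mul_right (Finset.dvd_prod_of_mem f hy) y)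
        | zero => simp
        | add y z _ _ h h' => rw [mul_add]; exact dvd_add h h'
        | smul c y _ h => rw [smul_eq_mul, mul_left_comm]; exact h.mul_left c
    obtain ⟨s, hs, hs'⟩ := h2
    obtain ⟨n, hn, hn0⟩ : ∃ n : ℤ, (n : R) ∈ 𝔭 ∧ n ≠ 0 := by
      have : (𝔭.comap (algebraMap ℤ R)).IsMaximal :=
        Ideal.isMaximal_comap_of_isIntegral_of_isMaximal 𝔭
      obtain ⟨n, hn, hn0⟩ := Submodule.exists_mem_ne_zero_of_ne_bot
        (Ring.ne_bot_of_isMaximal_of_not_isField this Int.not_isField)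
      exact ⟨n, by simpa using hn, hn0⟩
    obtain ⟨r, hr⟩ := hs' _ hn
    have hr' : (s : K) * n = a * r := by exact_mod_cast congrArg (Subtype.val) hr
    obtain ⟨i, hi⟩ : ∃ i : K, i * (n : K) = 1 :=
      ⟨algebraMap ℚ K (n : ℚ)⁻¹, by
        rw [← map_intCast (algebraMap ℚ K) n, ← map_mul,
          inv_mul_cancel₀ (by exact_mod_cast hn0), map_one]⟩
    have hx : (s * r * i : K) ∈ colonSub (R := R) 1 (Submodule.map (Algebra.linearMap ↥R K) 𝔭) := by
      rintro _ ⟨y, hy, rfl⟩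
      obtain ⟨r', hr''⟩ := hs' y hy
      have hr3 : (s : K) * y = a * r' := by exact_mod_cast congrArg (Subtype.val) hr''
      refine Submodule.mem_one.2 ⟨r' * s, ?_⟩
      change (r' * s : K) = s * r * i * y
      linear_combination (-r' * s : K) * hi + (r' * i : K) * hr' - r * i * hr3
    apply le_antisymm
    · rw [Submodule.mul_le]
      intro m hm x hx
      rw [mul_comm]
      exact hx m hm
    · obtain ⟨b, hb⟩ : ∃ b : R, b * (s * s) - 1 ∈ 𝔭 := by
        have hss : s * s ∉ 𝔭 := fun hh => (Ideal.IsPrime.mem_or_mem inferInstance hh).elim hs hs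
        obtain ⟨b, hb⟩ := Ideal.IsMaximal.exists_inv (I := 𝔭) inferInstance hss
        obtain ⟨i, hi, hbi⟩ := hb
        exact ⟨b, by rw [← hbi]; simpa using hi⟩
      rw [Submodule.one_le]
      have e1 := Submodule.mul_mem_mul (Submodule.mem_map_of_mem (f := Algebra.linearMap R K) ha) hx
      have h1c : (1 : K) ∈ colonSub (R := R) 1 (Submodule.map (Algebra.linearMap ↥R K) 𝔭) := by
        rintro _ ⟨y, hy, rfl⟩
        rw [one_mul]
        exact Submodule.mem_one.2 ⟨y, rfl⟩
      have e2 := Submodule.mul_mem_mul (Submodule.mem_map_of_mem (f := Algebra.linearMap R K) hb) h1c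
      have e3 := Submodule.sub_mem _ (Submodule.smul_mem _ b e1) e2
      convert e3 using 1
      change (1 : K) = b * (a * (s * r * i)) - (b * (s * s) - 1) * 1
      linear_combination (-b * s * s : K) * hi + (b * s * i : K) * hr'
end

section
/- Let R be an order in an étale ℚ-algebra K. Then R is a Bass order (every over-order of R is Gorenstein) if and only if every fractional R-ideal I is invertible in its own multiplicator ring S = (I:I), i.e. I·(S:I) = S. (Equivalently, every ideal class of R lies in the Picard group of some over-order of R.) -/
/-!
Setting: `K` is an étale `ℚ`-algebra (a commutative `ℚ`-algebra, reduced and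
finite-dimensional over `ℚ`), and `R` is an order in `K`: a subring of `K`
(equivalently a `ℤ`-subalgebra) that is finitely generated as a `ℤ`-module and
spans `K` over `ℚ`.  A fractional `R`-ideal is a finitely generated
`R`-submodule of `K` spanning `K` over `ℚ`.
-/

open Submodule

variable {K : Type*} [CommRing K] [Algebra ℚ K]
variable {R : Subalgebra ℤ K}

theorem bassaux_nondeg [FiniteDimensional ℚ K] [IsReduced K] :
    (Algebra.traceForm ℚ K).Nondegenerate := by
  have hart : IsArtinianRing K := IsArtinianRing.of_finite ℚ K
  have key : ∀ x : K, (∀ y, Algebra.trace ℚ K (x * y) = 0) → x = 0 := by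
    intro x hx
    obtain ⟨n, z, hz⟩ := IsArtinian.exists_pow_succ_smul_dvd x (1 : K)
    simp only [smul_eq_mul, mul_one] at hz
    have h0 : x * (1 - x * z) = 0 := by
      apply eq_zero_of_pow_eq_zero (n := n + 1)
      have : x ^ n * (1 - x * z) = 0 := by
        rw [Nat.succ_eq_add_one, pow_succ] at hz
        linear_combination -hz
      rw [mul_pow, pow_succ, pow_succ (1 - x * z)]
      linear_combination (x * (1 - x * z) ^ n) * this
    have hidem : IsIdempotentElem (x * z) := by
      unfold IsIdempotentElem
      linear_combination (-z) * h0
    have hidem' : IsIdempotentElem (Algebra.lmul ℚ K (x * z)) := by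
      unfold IsIdempotentElem
      rw [← map_mul, hidem]
    have h1 : Algebra.lmul ℚ K (x * z) = 0 := by
      apply LinearMap.IsIdempotentElem.eq_zero_of_trace_eq_zero hidem'
      exact hx z
    have h2 : x * z = 0 := by
      have := LinearMap.congr_fun h1 1
      simpa using this
    rw [h2] at h0
    simpa using h0
  constructor
  · intro x hx
    exact key x fun y => hx y
  · intro x hx
    exact key x fun y => by rw [mul_comm]; exact hx y

theorem bassaux_dual_eq (I : Submodule ↥R K) :
    (traceDualSub I).restrictScalars ℤ
      = (Algebra.traceForm ℚ K).dualSubmodule (I.restrictScalars ℤ) := by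
  ext x
  simp only [Submodule.restrictScalars_mem, LinearMap.BilinForm.mem_dualSubmodule,
    Submodule.mem_one, Algebra.traceForm_apply]
  change (∀ y ∈ I, ∃ n : ℤ, _ = _) ↔ _
  refine forall₂_congr fun y _ => exists_congr fun n => ?_
  simp [eq_comm]

theorem bassaux_basis (hRfin : Module.Finite ℤ R)
    (I : Submodule ↥R K) (hI : I.FG) (hs : Submodule.span ℚ (I : Set K) = ⊤) :
    ∃ (n : ℕ) (b : Module.Basis (Fin n) ℚ K),
      I.restrictScalars ℤ = Submodule.span ℤ (Set.range b) := by
  have hL : Submodule.IsLattice ℚ (I.restrictScalars ℤ) := ⟨hI.restrictScalars, hs⟩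
  let b := Module.finBasis ℤ (I.restrictScalars ℤ)
  refine ⟨_, b.extendOfIsLattice ℚ, ?_⟩
  have : (b.extendOfIsLattice ℚ : _ → K) = (I.restrictScalars ℤ).subtype ∘ b := by
    ext k
    simp
  rw [this, Set.range_comp, ← Submodule.map_span, b.span_eq, Submodule.map_top,
    Submodule.range_subtype]

theorem bassaux_dual_lattice [FiniteDimensional ℚ K] [IsReduced K] (hRfin : Module.Finite ℤ R)
    (I : Submodule ↥R K) (hI : I.FG) (hs : Submodule.span ℚ (I : Set K) = ⊤) :
    (traceDualSub I).FG ∧ Submodule.span ℚ (traceDualSub I : Set K) = ⊤ := by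
  classical
  obtain ⟨n, b, hb⟩ := bassaux_basis hRfin I hI hs
  have h := bassaux_dual_eq I
  rw [hb, LinearMap.BilinForm.dualSubmodule_span_of_basis _ bassaux_nondeg] at h
  constructor
  · apply Submodule.FG.of_restrictScalars ℤ
    rw [h]
    exact Submodule.fg_span (Set.finite_range _)
  · have h' : (traceDualSub I : Set K) = ((traceDualSub I).restrictScalars ℤ : Set K) := rfl
    rw [h', h, Submodule.span_span_of_tower, Module.Basis.span_eq]

theorem bassaux_dual_dual [FiniteDimensional ℚ K] [IsReduced K] (hRfin : Module.Finite ℤ R)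
    (I : Submodule ↥R K) (hI : I.FG) (hs : Submodule.span ℚ (I : Set K) = ⊤) :
    traceDualSub (traceDualSub I) = I := by
  obtain ⟨n, b, hb⟩ := bassaux_basis hRfin I hI hs
  apply Submodule.restrictScalars_injective ℤ
  rw [bassaux_dual_eq, bassaux_dual_eq, hb]
  exact LinearMap.BilinForm.dualSubmodule_dualSubmodule_of_basis _ bassaux_nondeg
    (Algebra.traceForm_isSymm ℚ) b

theorem bassaux_mul_span (I J : Submodule ↥R K)
    (hI : Submodule.span ℚ (I : Set K) = ⊤) (hJ : Submodule.span ℚ (J : Set K) = ⊤) :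
    Submodule.span ℚ ((I * J : Submodule ↥R K) : Set K) = ⊤ := by
  rw [eq_top_iff]
  have h : (⊤ : Submodule ℚ K) ≤ ⊤ * ⊤ := fun x _ => by
    simpa using Submodule.mul_mem_mul (Submodule.mem_top (x := x) (R := ℚ))
      (Submodule.mem_top (x := (1 : K)) (R := ℚ))
  refine h.trans ?_
  rw [← hI]
  nth_rewrite 2 [hI]
  rw [← hJ, Submodule.span_mul_span]
  apply Submodule.span_mono
  rintro _ ⟨x, hx, y, hy, rfl⟩
  exact Submodule.mul_mem_mul hx hy

theorem bassaux_mem_dual_mul (I J : Submodule ↥R K) (x : K) :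
    x ∈ traceDualSub (I * J) ↔ ∀ y ∈ I, x * y ∈ traceDualSub J := by
  constructor
  · intro h y hy z hz
    rw [mul_assoc]
    exact h _ (Submodule.mul_mem_mul hy hz)
  · intro h w hw
    refine Submodule.mul_induction_on hw (fun y hy z hz => ?_) (fun a b ha hb => ?_)
    · rw [← mul_assoc]
      exact h y hy z hz
    · obtain ⟨n, hn⟩ := ha
      obtain ⟨m, hm⟩ := hb
      refine ⟨n + m, ?_⟩
      rw [mul_add, map_add, hn, hm]
      push_cast
      ring

/-- Let `R` be an order in an étale `ℚ`-algebra `K`.  Then `R` is a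
Bass order — every over-order `S` of `R` (an order with `R ⊆ S ⊆ K`, equivalently a
fractional `R`-ideal that is a subring of `K`) is Gorenstein, i.e. `S^t·(S:S^t) = S` —
if and only if every fractional `R`-ideal `I` is invertible in its own multiplicator
ring `S = (I:I)`, i.e. `I·(S:I) = S`. -/
theorem bass_iff_every_ideal_invertible_in_multiplicator_ring
    [FiniteDimensional ℚ K] [IsReduced K]
    (hRfin : Module.Finite ℤ R) (hRspan : Submodule.span ℚ (R : Set K) = ⊤) :
    (∀ S : Submodule ↥R K, S.FG → Submodule.span ℚ (S : Set K) = ⊤ →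
        (1 : K) ∈ S → S * S ≤ S →
        traceDualSub S * colonSub S (traceDualSub S) = S) ↔
      (∀ I : Submodule ↥R K, I.FG → Submodule.span ℚ (I : Set K) = ⊤ →
        I * colonSub (colonSub I I) I = colonSub I I) := by
  constructor
  · intro H I hI hIs
    obtain ⟨hD, hDs⟩ := bassaux_dual_lattice hRfin I hI hIs
    have hP : (I * traceDualSub I).FG := hI.mul hD
    have hPs := bassaux_mul_span I (traceDualSub I) hIs hDs
    have hS : colonSub I I = traceDualSub (I * traceDualSub I) := by
      ext x
      rw [bassaux_mem_dual_mul, bassaux_dual_dual hRfin I hI hIs]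
      rfl
    have hSt : traceDualSub (colonSub I I) = I * traceDualSub I := by
      rw [hS, bassaux_dual_dual hRfin _ hP hPs]
    obtain ⟨hSf, hSs⟩ := bassaux_dual_lattice hRfin _ hP hPs
    rw [← hS] at hSf hSs
    have hG := H (colonSub I I) hSf hSs (fun y hy => by simpa using hy)
      (Submodule.mul_le.2 fun a ha b hb y hy => by
        rw [mul_assoc]; exact ha _ (hb y hy))
    apply le_antisymm
    · refine Submodule.mul_le.2 fun y hy z hz => ?_
      rw [mul_comm]
      exact hz y hy
    · conv_lhs => rw [← hG, hSt, mul_assoc]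
      refine mul_le_mul' le_rfl (Submodule.mul_le.2 fun a ha b hb y hy => ?_)
      have : a * b * y = b * (y * a) := by ring
      rw [this]
      exact hb _ (Submodule.mul_mem_mul hy ha)
  · intro H S hS hSs h1 hmul
    obtain ⟨hD, hDs⟩ := bassaux_dual_lattice hRfin S hS hSs
    have key : colonSub (traceDualSub S) (traceDualSub S) = S := by
      apply le_antisymm
      · intro x hx
        rw [← bassaux_dual_dual hRfin S hS hSs]
        intro y hy
        simpa using hx y hy 1 h1
      · intro s hs y hy z hz
        have : s * y * z = y * (s * z) := by ring
        rw [this]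
        exact hy _ (hmul (Submodule.mul_mem_mul hs hz))
    have := H (traceDualSub S) hD hDs
    rwa [key] at this
end

section
/- Let R be an order in an étale ℚ-algebra K and let I and J be fractional R-ideals. Then I_𝔭 and J_𝔭 are isomorphic as R_𝔭-modules for every maximal ideal 𝔭 of R if and only if 1 ∈ (I:J)(J:I). -/
/-!
Setting: `K` is an étale `ℚ`-algebra (a commutative `ℚ`-algebra, reduced and
finite-dimensional over `ℚ`), and `R` is an order in `K`: a subring of `K`
(equivalently a `ℤ`-subalgebra) that is finitely generated as a `ℤ`-module and
spans `K` over `ℚ`.  A fractional `R`-ideal is a finitely generated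
`R`-submodule of `K` spanning `K` over `ℚ`.
-/

open Submodule

variable {K : Type*} [CommRing K] [Algebra ℚ K]
variable {R : Subalgebra ℤ K}

theorem aux_denom {K : Type*} [CommRing K] [Algebra ℚ K] (A : AddSubgroup K) (x : K)
    (hx : x ∈ Submodule.span ℚ (A : Set K)) : ∃ n : ℤ, n ≠ 0 ∧ (n : K) * x ∈ A := by
  induction hx using Submodule.span_induction with
  | mem x h => exact ⟨1, one_ne_zero, by simpa using h⟩
  | zero => exact ⟨1, one_ne_zero, by simp⟩
  | add x y _ _ hx hy =>
    obtain ⟨n, hn, h1⟩ := hx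
    obtain ⟨m, hm, h2⟩ := hy
    refine ⟨n * m, mul_ne_zero hn hm, ?_⟩
    have := A.add_mem (A.zsmul_mem h1 m) (A.zsmul_mem h2 n)
    simp only [zsmul_eq_mul] at this
    convert this using 1
    push_cast; ring
  | smul q x _ hx =>
    obtain ⟨n, hn, h1⟩ := hx
    refine ⟨q.den * n, mul_ne_zero (by exact_mod_cast q.den_nz) hn, ?_⟩
    have := A.zsmul_mem h1 q.num
    simp only [zsmul_eq_mul] at this
    convert this using 1
    have h : (algebraMap ℚ K q) * (q.den : K) = (q.num : K) := by
      have := congrArg (algebraMap ℚ K) (Rat.mul_den_eq_num q)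
      rwa [map_mul, map_natCast, map_intCast] at this
    rw [Algebra.smul_def]
    push_cast
    rw [← h]; ring

theorem aux_unit {K : Type*} [CommRing K] [Algebra ℚ K] {n : ℤ} (hn : n ≠ 0) :
    IsUnit (n : K) := by
  have : IsUnit (n : ℚ) := IsUnit.mk0 _ (by exact_mod_cast hn)
  simpa using this.map (algebraMap ℚ K)

theorem aux_int {K : Type*} [CommRing K] [Algebra ℚ K] {R : Subalgebra ℤ K}
    (I : Submodule ↥R K) (hI : Submodule.span ℚ (I : Set K) = ⊤) :
    ∃ n : ℤ, n ≠ 0 ∧ (n : K) ∈ I := by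
  obtain ⟨n, hn, h⟩ := aux_denom I.toAddSubgroup 1 (by
    change 1 ∈ Submodule.span ℚ (I : Set K)
    rw [hI]; trivial)
  exact ⟨n, hn, by simpa using h⟩

theorem aux_hom {K : Type*} [CommRing K] [Algebra ℚ K] {R : Subalgebra ℤ K}
    (hR : Submodule.span ℚ (R : Set K) = ⊤)
    (I J : Submodule ↥R K) (hI : Submodule.span ℚ (I : Set K) = ⊤) (f : I →ₗ[R] J) :
    ∃ x ∈ colonSub J I, ∀ a : I, (f a : K) = x * a := by
  obtain ⟨n, hn, hnI⟩ := aux_int I hI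
  obtain ⟨u, hu⟩ := aux_unit (K := K) hn
  have key : ∀ a : I, (f a : K) = (↑u⁻¹ * (f ⟨n, hnI⟩ : K)) * a := by
    intro a
    obtain ⟨m, hm, hma⟩ := aux_denom R.toSubring.toAddSubgroup (a : K) (by
      change (a : K) ∈ Submodule.span ℚ (R : Set K)
      rw [hR]; trivial)
    have hma' : (m : K) * a ∈ R := hma
    have h1 : (⟨(m : K) * a, hma'⟩ : R) • (⟨n, hnI⟩ : I) = ((n * m : ℤ) : R) • a := by
      ext
      simp [Subalgebra.smul_def]
      ring
    have h2 := congrArg (fun z => ((f z : J) : K)) h1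
    simp only [map_smul] at h2
    simp [Subalgebra.smul_def] at h2
    apply (aux_unit (K := K) hm).mul_left_cancel
    apply (aux_unit (K := K) hn).mul_left_cancel
    have h3 : (n : K) * ↑u⁻¹ = 1 := by rw [← hu]; simp
    linear_combination (-1 : K) * h2 - (m * (f ⟨n, hnI⟩ : K) * a) * h3
  refine ⟨_, ?_, key⟩
  intro y hy
  rw [← key ⟨y, hy⟩]
  exact (f ⟨y, hy⟩).2

theorem aux_lift {A M N : Type*} [CommRing A] [AddCommGroup M] [Module A M] [AddCommGroup N]
    [Module A N] [Module.FinitePresentation A M] [Module.FinitePresentation A N]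
    (S : Submonoid A)
    (e : LocalizedModule S M ≃ₗ[Localization S] LocalizedModule S N) :
    ∃ (f : M →ₗ[A] N) (g : N →ₗ[A] M) (s : A), s ∈ S ∧
      ∀ m, ∃ c ∈ S, c • g (f m) = c • s • m := by
  let e' := e.restrictScalars A
  obtain ⟨f, s, hf⟩ := Module.FinitePresentation.exists_lift_of_isLocalizedModule S
    (LocalizedModule.mkLinearMap S N)
    (e'.toLinearMap ∘ₗ LocalizedModule.mkLinearMap S M)
  obtain ⟨g, t, hg⟩ := Module.FinitePresentation.exists_lift_of_isLocalizedModule S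
    (LocalizedModule.mkLinearMap S M)
    (e'.symm.toLinearMap ∘ₗ LocalizedModule.mkLinearMap S N)
  refine ⟨f, g, t * s, S.mul_mem t.2 s.2, fun m => ?_⟩
  have h1 : LocalizedModule.mkLinearMap S M (g (f m)) =
      LocalizedModule.mkLinearMap S M (((t : A) * s) • m) := by
    have a1 := LinearMap.congr_fun hg (f m)
    have a2 := LinearMap.congr_fun hf m
    simp only [LinearMap.comp_apply, LinearMap.smul_apply, LinearEquiv.coe_coe] at a1 a2
    rw [a1, a2, Submonoid.smul_def, Submonoid.smul_def, map_smul, LinearEquiv.symm_apply_apply,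
      map_smul, smul_smul]
  obtain ⟨c, hc⟩ := (IsLocalizedModule.eq_iff_exists S _).mp h1
  exact ⟨c, c.2, hc⟩

theorem aux_equiv {A M N : Type*} [CommRing A] [AddCommGroup M] [Module A M] [AddCommGroup N]
    [Module A N] (S : Submonoid A) (f : M →ₗ[A] N) (g : N →ₗ[A] M) (s : A) (hs : s ∈ S)
    (hgf : ∀ a, g (f a) = s • a) (hfg : ∀ a, f (g a) = s • a) :
    Nonempty (LocalizedModule S M ≃ₗ[Localization S] LocalizedModule S N) := by
  let F := LocalizedModule.map S f
  refine ⟨LinearEquiv.ofBijective F ⟨?_, ?_⟩⟩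
  · rw [← LinearMap.ker_eq_bot, LinearMap.ker_eq_bot']
    intro m hm
    induction m using LocalizedModule.induction_on with
    | h m t =>
      rw [LocalizedModule.map_mk, ← LocalizedModule.zero_mk 1, LocalizedModule.mk_eq] at hm
      obtain ⟨u, hu⟩ := hm
      rw [← LocalizedModule.zero_mk 1, LocalizedModule.mk_eq]
      refine ⟨u * ⟨s, hs⟩, ?_⟩
      have := congrArg g hu
      simp only [one_smul, smul_zero, map_zero, Submonoid.smul_def, map_smul, hgf] at this ⊢
      rw [← this, smul_smul]; rfl
  · intro m
    induction m using LocalizedModule.induction_on with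
    | h m t =>
      refine ⟨LocalizedModule.mk (g m) (⟨s, hs⟩ * t), ?_⟩
      rw [LocalizedModule.map_mk, hfg]
      exact LocalizedModule.mk_cancel_common_left ⟨s, hs⟩ t m

theorem aux_forward {K : Type*} [CommRing K] [Algebra ℚ K] {R : Subalgebra ℤ K}
    (hRfin : Module.Finite ℤ R) (hR : Submodule.span ℚ (R : Set K) = ⊤)
    (I J : Submodule ↥R K)
    (hIfg : I.FG) (hI : Submodule.span ℚ (I : Set K) = ⊤)
    (hJfg : J.FG) (hJ : Submodule.span ℚ (J : Set K) = ⊤)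
    (p : Ideal R) [p.IsMaximal]
    (e : LocalizedModule p.primeCompl ↥I ≃ₗ[Localization.AtPrime p]
          LocalizedModule p.primeCompl ↥J) :
    ∃ s : R, s ∉ p ∧ (s : K) ∈ colonSub I J * colonSub J I := by
  have : IsNoetherianRing R := IsNoetherianRing.of_finite ℤ R
  have : Module.Finite R I := Module.Finite.iff_fg.mpr hIfg
  have : Module.Finite R J := Module.Finite.iff_fg.mpr hJfg
  have : Module.FinitePresentation R I := Module.finitePresentation_of_finite R I
  have : Module.FinitePresentation R J := Module.finitePresentation_of_finite R J
  obtain ⟨f, g, s, hs, H⟩ := aux_lift p.primeCompl e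
  obtain ⟨x, hx, hfx⟩ := aux_hom hR I J hI f
  obtain ⟨y, hy, hgy⟩ := aux_hom hR J I hJ g
  obtain ⟨n, hn, hnI⟩ := aux_int I hI
  obtain ⟨c, hcp, hc⟩ := H ⟨n, hnI⟩
  have hc' := congrArg (fun z : I => (z : K)) hc
  simp [Subalgebra.smul_def, hfx, hgy] at hc'
  refine ⟨c * s, p.primeCompl.mul_mem hcp hs, ?_⟩
  have h3 : ((c * s : R) : K) = c • (y * x) := by
    apply (aux_unit (K := K) hn).mul_left_cancel
    simp [Subalgebra.smul_def]
    linear_combination -hc'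
  rw [h3]
  exact Submodule.smul_mem _ _ (Submodule.mul_mem_mul hy hx)

/-- multiplier ring -/
def auxS {K : Type*} [CommRing K] [Algebra ℚ K] {R : Subalgebra ℤ K}
    (I : Submodule ↥R K) : Subalgebra R K where
  carrier := colonSub I I
  mul_mem' := fun {a b} ha hb y hy => by
    rw [mul_assoc]; exact ha _ (hb y hy)
  add_mem' := fun ha hb => (colonSub I I).add_mem ha hb
  algebraMap_mem' := fun r y hy => by
    have := I.smul_mem r hy
    rwa [Algebra.smul_def] at this

theorem auxS_finite {K : Type*} [CommRing K] [Algebra ℚ K] {R : Subalgebra ℤ K}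
    (hRfin : Module.Finite ℤ R) (I : Submodule ↥R K)
    (hIfg : I.FG) (hI : Submodule.span ℚ (I : Set K) = ⊤) : Module.Finite R (auxS I) := by
  have : IsNoetherianRing R := IsNoetherianRing.of_finite ℤ R
  have : Module.Finite R I := Module.Finite.iff_fg.mpr hIfg
  obtain ⟨n, hn, hnI⟩ := aux_int I hI
  let φ : auxS I →ₗ[R] I :=
    { toFun := fun s => ⟨s * n, s.2 _ hnI⟩
      map_add' := fun a b => by ext; simp [add_mul]
      map_smul' := fun r a => by ext; simp }
  refine Module.Finite.of_injective φ ?_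
  intro a b hab
  have := congrArg (fun z : I => (z : K)) hab
  exact Subtype.ext ((aux_unit (K := K) hn).mul_right_cancel this)

theorem aux_backward {K : Type*} [CommRing K] [Algebra ℚ K] {R : Subalgebra ℤ K}
    (hRfin : Module.Finite ℤ R)
    (I J : Submodule ↥R K)
    (hIfg : I.FG) (hI : Submodule.span ℚ (I : Set K) = ⊤)
    (h : (1 : K) ∈ colonSub I J * colonSub J I)
    (p : Ideal R) [hp : p.IsMaximal] :
    ∃ s : R, s ∉ p ∧ ∃ x ∈ colonSub I J, ∃ y ∈ colonSub J I, x * y = s := by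
  have := auxS_finite hRfin I hIfg hI
  have hfin : (p.primesOver (auxS I)).Finite := Algebra.QuasiFinite.finite_primesOver p
  have := hfin.fintype
  classical
  have hmul : ∀ a ∈ colonSub I J, ∀ b ∈ colonSub J I, a * b ∈ auxS I := by
    intro a ha b hb y hy
    rw [mul_assoc]; exact ha _ (hb _ hy)
  have hS : ∀ s ∈ auxS I, ∀ a ∈ colonSub I J, s * a ∈ colonSub I J := by
    intro s hs a ha y hy
    rw [mul_assoc]; exact hs _ (ha _ hy)
  have hS' : ∀ s ∈ auxS I, ∀ a ∈ colonSub J I, s * a ∈ colonSub J I := by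
    intro s hs a ha y hy
    rw [mul_comm s, mul_assoc]; exact ha _ (hs _ hy)
  have hmax : ∀ q : p.primesOver (auxS I), q.1.IsMaximal := by
    intro q
    have := q.2.1
    refine Ideal.isMaximal_of_isIntegral_of_isMaximal_comap (R := R) q.1 ?_
    have h2 := q.2.2.over
    rw [Ideal.under_def] at h2
    rwa [← h2]
  have hab : ∀ q : p.primesOver (auxS I), ∃ a, ∃ ha : a ∈ colonSub I J, ∃ b,
      ∃ hb : b ∈ colonSub J I, (⟨a * b, hmul a ha b hb⟩ : auxS I) ∉ q.1 := by
    intro q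
    by_contra hcon
    push Not at hcon
    apply (hmax q).ne_top
    rw [Ideal.eq_top_iff_one]
    have hle : ∀ z ∈ colonSub I J * colonSub J I, ∃ hz : z ∈ auxS I, (⟨z, hz⟩ : auxS I) ∈ q.1 := by
      intro z hz
      induction hz using Submodule.mul_induction_on' with
      | mem_mul_mem a ha b hb => exact ⟨hmul a ha b hb, hcon a ha b hb⟩
      | add x _ y _ hx hy =>
        obtain ⟨h1, h2⟩ := hx
        obtain ⟨h3, h4⟩ := hy
        exact ⟨add_mem h1 h3, q.1.add_mem h2 h4⟩
    obtain ⟨_, h1⟩ := hle 1 h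
    exact h1
  choose a ha b hb habq using hab
  have hcop : Pairwise (fun q q' : p.primesOver (auxS I) => IsCoprime q.1 q'.1) := by
    intro q q' hne
    have := hmax q
    have := hmax q'
    exact Ideal.isCoprime_of_isMaximal (fun h => hne (Subtype.ext h))
  have hcrt : ∀ q : p.primesOver (auxS I), ∃ e : auxS I, ∀ q', e - (if q' = q then 1 else 0) ∈ q'.1 :=
    fun q => Ideal.exists_forall_sub_mem_ideal hcop _
  choose e he using hcrt
  let x : K := ∑ q, (e q : K) * a q
  have hx : x ∈ colonSub I J := sum_mem fun q _ => hS _ (e q).2 _ (ha q)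
  let A : Ideal (auxS I) :=
    { carrier := {z | ∃ y ∈ colonSub J I, x * y = z}
      zero_mem' := ⟨0, zero_mem _, by simp⟩
      add_mem' := by
        rintro _ _ ⟨y, hy, h1⟩ ⟨y', hy', h1'⟩
        exact ⟨y + y', add_mem hy hy', by simp [mul_add, h1, h1']⟩
      smul_mem' := by
        rintro c _ ⟨y, hy, h1⟩
        exact ⟨c * y, hS' _ c.2 _ hy, by simp [← h1]; ring⟩ }
  by_contra hcon
  push Not at hcon
  have hA : A.comap (algebraMap R (auxS I)) ≤ p := by
    rintro r ⟨y, hy, h1⟩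
    by_contra hr
    exact hcon r hr x hx y hy h1
  obtain ⟨Q, hQA, hQ, hQp⟩ := Ideal.exists_ideal_over_prime_of_isIntegral p A hA
  let q : p.primesOver (auxS I) := ⟨Q, hQ, ⟨hQp.symm⟩⟩
  have h1 : (⟨x * b q, hmul x hx _ (hb q)⟩ : auxS I) ∈ Q := hQA ⟨b q, hb q, rfl⟩
  have h2 : (⟨x * b q, hmul x hx _ (hb q)⟩ : auxS I) =
      ∑ q', e q' * ⟨a q' * b q, hmul _ (ha q') _ (hb q)⟩ := by
    ext
    simp only [x, Finset.sum_mul, mul_assoc, AddSubmonoidClass.coe_finset_sum, MulMemClass.coe_mul]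
  rw [h2, ← Finset.add_sum_erase _ _ (Finset.mem_univ q)] at h1
  have h3 : ∑ q' ∈ Finset.univ.erase q, e q' * ⟨a q' * b q, hmul _ (ha q') _ (hb q)⟩ ∈ Q := by
    refine sum_mem fun q' hq' => Q.mul_mem_right _ ?_
    have := he q' q
    rwa [if_neg (Finset.ne_of_mem_erase hq').symm, sub_zero] at this
  have h4 := (Q.add_mem_iff_left h3).mp h1
  have h5 := he q q
  rw [if_pos rfl] at h5
  apply habq q
  have h6 := Q.sub_mem h4 (Q.mul_mem_right ⟨a q * b q, hmul _ (ha q) _ (hb q)⟩ h5)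
  rw [sub_mul, one_mul, sub_sub_cancel] at h6
  exact h6

theorem aux_iso {K : Type*} [CommRing K] [Algebra ℚ K] {R : Subalgebra ℤ K}
    (I J : Submodule ↥R K) (p : Ideal R) [p.IsPrime] (s : R) (hs : s ∉ p)
    (x : K) (hx : x ∈ colonSub I J) (y : K) (hy : y ∈ colonSub J I) (hxy : x * y = s) :
    Nonempty (LocalizedModule p.primeCompl ↥I ≃ₗ[Localization.AtPrime p]
          LocalizedModule p.primeCompl ↥J) := by
  let f : I →ₗ[R] J :=
    { toFun := fun a => ⟨y * a, hy _ a.2⟩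
      map_add' := fun a b => by ext; simp [mul_add]
      map_smul' := fun r a => by ext; simp }
  let g : J →ₗ[R] I :=
    { toFun := fun a => ⟨x * a, hx _ a.2⟩
      map_add' := fun a b => by ext; simp [mul_add]
      map_smul' := fun r a => by ext; simp }
  have hgf : ∀ a, g (f a) = s • a := by
    intro a; ext; simp [f, g, Subalgebra.smul_def, ← hxy]; ring
  have hfg : ∀ a, f (g a) = s • a := by
    intro a; ext; simp [f, g, Subalgebra.smul_def, ← hxy]; ring
  exact aux_equiv p.primeCompl f g s hs hgf hfg

/-- Let `R` be an order in an étale `ℚ`-algebra `K` and `I`, `J`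
fractional `R`-ideals.  Then the localizations `I_𝔭` and `J_𝔭` are isomorphic as
`R_𝔭`-modules for every maximal ideal `𝔭` of `R` if and only if
`1 ∈ (I:J)·(J:I)`  (i.e. `I` and `J` are weakly equivalent). -/
theorem locally_isomorphic_iff_one_mem_colon_mul
    [FiniteDimensional ℚ K] [IsReduced K]
    (hRfin : Module.Finite ℤ R) (hRspan : Submodule.span ℚ (R : Set K) = ⊤)
    (I J : Submodule ↥R K)
    (hIfg : I.FG) (hIspan : Submodule.span ℚ (I : Set K) = ⊤)
    (hJfg : J.FG) (hJspan : Submodule.span ℚ (J : Set K) = ⊤) :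
    (∀ (𝔭 : Ideal ↥R) [𝔭.IsMaximal],
        Nonempty (LocalizedModule 𝔭.primeCompl ↥I ≃ₗ[Localization.AtPrime 𝔭]
          LocalizedModule 𝔭.primeCompl ↥J)) ↔
      (1 : K) ∈ colonSub I J * colonSub J I := by
  constructor
  · intro h
    let T : Ideal R := (colonSub I J * colonSub J I).comap (Algebra.linearMap R K)
    have hT : T = ⊤ := by
      by_contra hne
      obtain ⟨p, hp, hTp⟩ := Ideal.exists_le_maximal T hne
      obtain ⟨e⟩ := h p
      obtain ⟨s, hs, hs'⟩ := aux_forward hRfin hRspan I J hIfg hIspan hJfg hJspan p e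
      exact hs (hTp hs')
    have h1 : (1 : R) ∈ T := by rw [hT]; trivial
    simpa [T] using h1
  · intro h p hp
    obtain ⟨s, hs, x, hx, y, hy, hxy⟩ := aux_backward hRfin I J hIfg hIspan h p
    exact aux_iso I J p s hs x hx y hy hxy
end

section
/- Let R be an order in an étale ℚ-algebra K and let I and J be fractional R-ideals. Then 1 ∈ (I:J)(J:I) if and only if I and J have the same multiplicator ring S = (I:I) = (J:J) and there exists a fractional ideal L invertible in S such that I = L·J. -/
/-!
Setting: `K` is an étale `ℚ`-algebra (a commutative `ℚ`-algebra, reduced and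
finite-dimensional over `ℚ`), and `R` is an order in `K`: a subring of `K`
(equivalently a `ℤ`-subalgebra) that is finitely generated as a `ℤ`-module and
spans `K` over `ℚ`.  A fractional `R`-ideal is a finitely generated
`R`-submodule of `K` spanning `K` over `ℚ`.
-/

open Submodule

variable {K : Type*} [CommRing K] [Algebra ℚ K]
variable {R : Subalgebra ℤ K}

theorem mem_colonSub_iff {I J : Submodule ↥R K} {x : K} :
    x ∈ colonSub I J ↔ ∀ y ∈ J, x * y ∈ I := Iff.rfl

theorem colonSub_mul_le' {A B C : Submodule ↥R K} :
    colonSub A B * colonSub B C ≤ colonSub A C := by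
  refine Submodule.mul_le.2 fun a ha b hb y hy => ?_
  rw [mul_assoc]
  exact ha _ (hb _ hy)

theorem colonSub_mul_self_le {A B : Submodule ↥R K} : colonSub A B * B ≤ A :=
  Submodule.mul_le.2 fun a ha b hb => ha b hb

theorem colonSub_fg_aux (hRfin : Module.Finite ℤ R) (I J : Submodule ↥R K)
    (hIfg : I.FG) (hJfg : J.FG) (hJspan : Submodule.span ℚ (J : Set K) = ⊤) :
    (colonSub I J).FG := by
  have hN : IsNoetherianRing R := by
    have : IsNoetherian ℤ R := isNoetherian_of_isNoetherianRing_of_finite ℤ R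
    exact isNoetherian_of_tower ℤ this
  have : Module.Finite R I := Module.Finite.iff_fg.2 hIfg
  have : Module.Finite R J := Module.Finite.iff_fg.2 hJfg
  have : IsNoetherian R (J →ₗ[R] I) := inferInstance
  let f : colonSub I J →ₗ[R] (J →ₗ[R] I) :=
    { toFun := fun x =>
        { toFun := fun y => ⟨x.1 * y.1, x.2 y.1 y.2⟩
          map_add' := fun a b => Subtype.ext (mul_add _ _ _)
          map_smul' := fun c a => Subtype.ext (mul_smul_comm _ _ _) }
      map_add' := fun a b => LinearMap.ext fun y => Subtype.ext (add_mul _ _ _)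
      map_smul' := fun c a => LinearMap.ext fun y => Subtype.ext (smul_mul_assoc _ _ _) }
  have hf : Function.Injective f := by
    refine (injective_iff_map_eq_zero f).2 fun x hx => Subtype.ext ?_
    have h0 : ∀ y ∈ Submodule.span ℚ (J : Set K), x.1 * y = 0 := by
      intro y hy
      induction hy using Submodule.span_induction with
      | mem y hy => exact congrArg Subtype.val (LinearMap.congr_fun hx ⟨y, hy⟩)
      | zero => simp
      | add a b _ _ ha hb => rw [mul_add, ha, hb, add_zero]
      | smul c a _ ha => rw [mul_smul_comm, ha, smul_zero]
    have := h0 1 (hJspan ▸ Submodule.mem_top)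
    simpa using this
  have : IsNoetherian R (colonSub I J) := isNoetherian_of_injective f hf
  exact Module.Finite.iff_fg.1 inferInstance

theorem span_eq_top_aux (hRspan : Submodule.span ℚ (R : Set K) = ⊤)
    (A B : Submodule ↥R K) (h : (1 : K) ∈ A * B) :
    Submodule.span ℚ (A : Set K) = ⊤ := by
  have key : ∀ a ∈ A, ∀ k : K, a * k ∈ Submodule.span ℚ (A : Set K) := by
    intro a ha k
    have hk : k ∈ Submodule.span ℚ (R : Set K) := hRspan ▸ Submodule.mem_top
    induction hk using Submodule.span_induction with
    | mem y hy =>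
      refine Submodule.subset_span ?_
      have := A.smul_mem (⟨y, hy⟩ : R) ha
      rw [mul_comm]
      exact this
    | zero => simp
    | add a b _ _ ha hb => rw [mul_add]; exact add_mem ha hb
    | smul c a _ ha => rw [mul_smul_comm]; exact Submodule.smul_mem _ _ ha
  refine Submodule.eq_top_iff'.2 fun k => ?_
  have h2 : ∀ z ∈ A * B, z * k ∈ Submodule.span ℚ (A : Set K) := by
    intro z hz
    induction hz using Submodule.mul_induction_on' with
    | mem_mul_mem a ha b hb => rw [mul_assoc]; exact key a ha _
    | add a _ b _ ha hb => rw [add_mul]; exact add_mem ha hb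
  simpa using h2 1 h

/-- Let `R` be an order in an étale `ℚ`-algebra `K` and `I`, `J`
fractional `R`-ideals.  Then `1 ∈ (I:J)·(J:I)` if and only if `I` and `J` have the
same multiplicator ring `S = (I:I) = (J:J)` and there exists a fractional ideal `L`
invertible in `S` (i.e. `L·(S:L) = S`) such that `I = L·J`. -/
theorem weakly_equivalent_iff_invertible_multiple
    [FiniteDimensional ℚ K] [IsReduced K]
    (hRfin : Module.Finite ℤ R) (hRspan : Submodule.span ℚ (R : Set K) = ⊤)
    (I J : Submodule ↥R K)
    (hIfg : I.FG) (hIspan : Submodule.span ℚ (I : Set K) = ⊤)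
    (hJfg : J.FG) (hJspan : Submodule.span ℚ (J : Set K) = ⊤) :
    (1 : K) ∈ colonSub I J * colonSub J I ↔
      (colonSub I I = colonSub J J ∧
        ∃ L : Submodule ↥R K, L.FG ∧ Submodule.span ℚ (L : Set K) = ⊤ ∧
          L * colonSub (colonSub I I) L = colonSub I I ∧ I = L * J) := by
  constructor
  · intro h
    have h' : (1 : K) ∈ colonSub J I * colonSub I J := by rwa [mul_comm]
    have e1 : colonSub I J * colonSub J I = colonSub I I := by
      refine le_antisymm colonSub_mul_le' fun x hx => ?_
      have : x * 1 ∈ colonSub I I * (colonSub I J * colonSub J I) := Submodule.mul_mem_mul hx h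
      rw [← mul_assoc, mul_one] at this
      exact Submodule.mul_le.2 (fun a ha b hb => Submodule.mul_mem_mul (colonSub_mul_le' ha) hb) this
    have e2 : colonSub J I * colonSub I J = colonSub J J := by
      refine le_antisymm colonSub_mul_le' fun x hx => ?_
      have : x * 1 ∈ colonSub J J * (colonSub J I * colonSub I J) := Submodule.mul_mem_mul hx h'
      rw [← mul_assoc, mul_one] at this
      exact Submodule.mul_le.2 (fun a ha b hb => Submodule.mul_mem_mul (colonSub_mul_le' ha) hb) this
    refine ⟨by rw [← e1, ← e2, mul_comm], colonSub I J,
      colonSub_fg_aux hRfin I J hIfg hJfg hJspan, span_eq_top_aux hRspan _ _ h, ?_, ?_⟩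
    · refine le_antisymm ?_ ?_
      · rw [mul_comm]; exact colonSub_mul_self_le
      · conv_lhs => rw [← e1]
        refine Submodule.mul_le.2 fun a ha b hb => Submodule.mul_mem_mul ha fun y hy => ?_
        rw [← e1, mul_comm b y]
        exact Submodule.mul_mem_mul hy hb
    · refine le_antisymm (fun x hx => ?_) colonSub_mul_self_le
      have : 1 * x ∈ (colonSub I J * colonSub J I) * I := Submodule.mul_mem_mul h hx
      rw [one_mul, mul_assoc] at this
      exact Submodule.mul_le.2
        (fun a ha b hb => Submodule.mul_mem_mul ha (colonSub_mul_self_le hb)) this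
  · rintro ⟨hS, L, -, -, hL, hI⟩
    have h1 : (1 : K) ∈ L * colonSub (colonSub I I) L := by
      rw [hL]
      intro y hy
      rwa [one_mul]
    refine Submodule.mul_le.2 (fun a ha b hb => Submodule.mul_mem_mul ?_ ?_) h1
    · intro y hy
      rw [hI]
      exact Submodule.mul_mem_mul ha hy
    · intro y hy
      rw [hI] at hy
      induction hy using Submodule.mul_induction_on' with
      | mem_mul_mem l hl j hj =>
        have := hb l hl
        rw [hS] at this
        rw [← mul_assoc]
        exact this j hj
      | add a _ c _ ha hc => rw [mul_add]; exact add_mem ha hc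
end

section
/- Let R be an order in an étale ℚ-algebra K and let I and J be weakly equivalent fractional R-ideals, with common multiplicator ring S = (I:I) = (J:J). Then I = (I:J)·J, the fractional ideal (I:J) is invertible in S, and I and J are isomorphic as R-modules if and only if (I:J) is a principal fractional S-ideal, i.e. (I:J) = xS for some x ∈ K^×. -/
/-!
Setting: `K` is an étale `ℚ`-algebra (a commutative `ℚ`-algebra, reduced and
finite-dimensional over `ℚ`), and `R` is an order in `K`: a subring of `K`
(equivalently a `ℤ`-subalgebra) that is finitely generated as a `ℤ`-module and
spans `K` over `ℚ`.  A fractional `R`-ideal is a finitely generated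
`R`-submodule of `K` spanning `K` over `ℚ`.
-/

open Submodule

variable {K : Type*} [CommRing K] [Algebra ℚ K]
variable {R : Subalgebra ℤ K}

theorem aux_int_mul_mem (N : AddSubgroup K) (h : Submodule.span ℚ (N : Set K) = ⊤) (k : K) :
    ∃ n : ℤ, n ≠ 0 ∧ n • k ∈ N := by
  have hk : k ∈ Submodule.span ℚ (N : Set K) := by rw [h]; trivial
  induction hk using Submodule.span_induction with
  | mem x hx => exact ⟨1, one_ne_zero, by simpa using hx⟩
  | zero => exact ⟨1, one_ne_zero, by simp [N.zero_mem]⟩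
  | add x y _ _ hx hy =>
    obtain ⟨n, hn, hx⟩ := hx
    obtain ⟨m, hm, hy⟩ := hy
    refine ⟨n * m, mul_ne_zero hn hm, ?_⟩
    have h1 := N.zsmul_mem hx m
    have h2 := N.zsmul_mem hy n
    have := N.add_mem h1 h2
    rw [smul_add, mul_smul, mul_smul, smul_comm n m x]
    exact this
  | smul q x _ hx =>
    obtain ⟨n, hn, hx⟩ := hx
    refine ⟨n * q.den, mul_ne_zero hn (by exact_mod_cast q.den_nz), ?_⟩
    have h1 := N.zsmul_mem hx q.num
    have e : (n * (q.den : ℤ)) • (q • x) = q.num • (n • x) := by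
      rw [← Int.cast_smul_eq_zsmul ℚ, ← Int.cast_smul_eq_zsmul ℚ q.num,
        ← Int.cast_smul_eq_zsmul ℚ n, smul_smul, smul_smul]
      congr 1
      push_cast
      rw [mul_assoc, Rat.den_mul_eq_num, mul_comm]
    rw [e]; exact h1

theorem aux_zsmul_cancel {n : ℤ} (hn : n ≠ 0) {a b : K} (h : n • a = n • b) : a = b := by
  rw [← Int.cast_smul_eq_zsmul ℚ, ← Int.cast_smul_eq_zsmul ℚ n b] at h
  have hq : (n : ℚ) ≠ 0 := by exact_mod_cast hn
  have := congrArg (fun z => (n : ℚ)⁻¹ • z) h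
  simpa [smul_smul, hq] using this

theorem aux_isUnit_zsmul {n : ℤ} (hn : n ≠ 0) : IsUnit (n • (1 : K)) := by
  have hq : (n : ℚ) ≠ 0 := by exact_mod_cast hn
  have := (IsUnit.mk0 _ hq).map (algebraMap ℚ K)
  simpa using this

theorem aux_iso_s15 (hRspan : Submodule.span ℚ (R : Set K) = ⊤) (I J : Submodule ↥R K)
    (hIspan : Submodule.span ℚ (I : Set K) = ⊤)
    (hJspan : Submodule.span ℚ (J : Set K) = ⊤) (f : ↥J ≃ₗ[↥R] ↥I) :
    ∃ x : K, IsUnit x ∧ ∀ z : J, (f z : K) = x * z := by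
  have key : ∀ y z : J, (y : K) * f z = z * f y := by
    intro y z
    obtain ⟨n, hn, hy⟩ := aux_int_mul_mem R.toSubring.toAddSubgroup hRspan (y : K)
    obtain ⟨m, hm, hz⟩ := aux_int_mul_mem R.toSubring.toAddSubgroup hRspan (z : K)
    have e : m • ((⟨n • (y : K), hy⟩ : R) • z) = n • ((⟨m • (z : K), hz⟩ : R) • y) := by
      apply Subtype.ext
      change m • ((n • (y : K)) * z) = n • ((m • (z : K)) * y)
      simp only [zsmul_eq_mul]; ring
    have e2 := congrArg (fun w => (f w : K)) e
    simp only [map_zsmul, map_smul] at e2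
    change m • ((n • (y : K)) * f z) = n • ((m • (z : K)) * f y) at e2
    apply aux_zsmul_cancel (mul_ne_zero hn hm)
    simp only [zsmul_eq_mul] at e2 ⊢
    push_cast
    linear_combination e2
  obtain ⟨n, hn, h1⟩ := aux_int_mul_mem J.toAddSubgroup hJspan 1
  obtain ⟨m, hm, h2⟩ := aux_int_mul_mem I.toAddSubgroup hIspan 1
  obtain ⟨u, hu⟩ := aux_isUnit_zsmul (K := K) hn
  have hx : ∀ z : J, (f z : K) = (↑u⁻¹ * (f ⟨n • 1, h1⟩ : K)) * z := by
    intro z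
    have := key ⟨n • 1, h1⟩ z
    simp only [← hu] at this
    calc (f z : K) = ↑u⁻¹ * (u * f z) := by simp
      _ = _ := by rw [this]; simp only [hu]; ring
  refine ⟨_, ?_, hx⟩
  have h3 := hx (f.symm ⟨m • 1, h2⟩)
  rw [f.apply_symm_apply] at h3
  have h4 := aux_isUnit_zsmul (K := K) hm
  change m • (1 : K) = _ at h3
  rw [h3] at h4
  exact isUnit_of_mul_isUnit_left h4

theorem aux_map (I J : Submodule ↥R K) (x : K) (hx : IsUnit x)
    (h : I = Submodule.map (LinearMap.mulLeft R x) J) :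
    colonSub I J = Submodule.map (LinearMap.mulLeft R x) (colonSub J J) := by
  obtain ⟨u, rfl⟩ := hx
  ext a
  rw [h, Submodule.mem_map]
  constructor
  · intro ha
    refine ⟨↑u⁻¹ * a, ?_, by simp⟩
    intro y hy
    obtain ⟨z, hz, e⟩ := ha y hy
    have : (↑u⁻¹ * a) * y = z := by
      rw [mul_assoc, ← e]; simp
    rw [this]; exact hz
  · rintro ⟨b, hb, rfl⟩ y hy
    exact ⟨b * y, hb y hy, by simp [mul_assoc]⟩

/-- Let `R` be an order in an étale `ℚ`-algebra `K` and `I`, `J`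
weakly equivalent fractional `R`-ideals (`1 ∈ (I:J)(J:I)`), with common multiplicator
ring `S = (I:I) = (J:J)`.  Then `I = (I:J)·J`, the fractional ideal `(I:J)` is
invertible in `S` (i.e. `(I:J)·(S:(I:J)) = S`), and `I ≅ J` as `R`-modules if and only
if `(I:J)` is a principal fractional `S`-ideal, i.e. `(I:J) = x·S` for some unit
`x ∈ K^×`. -/
theorem weakly_equivalent_colon_invertible_and_iso_iff_principal
    [FiniteDimensional ℚ K] [IsReduced K]
    (hRfin : Module.Finite ℤ R) (hRspan : Submodule.span ℚ (R : Set K) = ⊤)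
    (I J : Submodule ↥R K)
    (hIfg : I.FG) (hIspan : Submodule.span ℚ (I : Set K) = ⊤)
    (hJfg : J.FG) (hJspan : Submodule.span ℚ (J : Set K) = ⊤)
    (hwk : (1 : K) ∈ colonSub I J * colonSub J I)
    (hS : colonSub I I = colonSub J J) :
    I = colonSub I J * J ∧
      colonSub I J * colonSub (colonSub I I) (colonSub I J) = colonSub I I ∧
      (Nonempty (↥I ≃ₗ[↥R] ↥J) ↔
        ∃ x : K, IsUnit x ∧
          colonSub I J = Submodule.map (LinearMap.mulLeft R x) (colonSub I I)) := by
  have hAJ : colonSub I J * J ≤ I := Submodule.mul_le.2 fun a ha b hb => ha b hb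
  have hBI : colonSub J I * I ≤ J := Submodule.mul_le.2 fun a ha b hb => ha b hb
  have h1 : I = colonSub I J * J := by
    refine le_antisymm (fun y hy => ?_) hAJ
    have := Submodule.mul_mem_mul hwk hy
    rw [one_mul, mul_assoc] at this
    exact mul_le_mul' le_rfl hBI this
  refine ⟨h1, ?_, ?_⟩
  · apply le_antisymm
    · rw [mul_comm]
      exact Submodule.mul_le.2 fun a ha b hb => ha b hb
    · intro s hs
      have := Submodule.mul_mem_mul hs hwk
      rw [mul_one, ← mul_assoc] at this
      refine (mul_le_mul' ?_ ?_ : colonSub I I * colonSub I J * colonSub J I ≤ _) this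
      · refine Submodule.mul_le.2 fun a ha b hb y hy => ?_
        rw [mul_assoc]; exact ha _ (hb y hy)
      · intro b hb a ha y hy
        rw [mul_comm b a, mul_assoc]
        exact ha _ (hb y hy)
  · constructor
    · rintro ⟨e⟩
      obtain ⟨x, hx, hf⟩ := aux_iso_s15 hRspan I J hIspan hJspan e.symm
      refine ⟨x, hx, ?_⟩
      rw [hS]
      refine aux_map I J x hx ?_
      ext a
      rw [Submodule.mem_map]
      constructor
      · intro ha
        refine ⟨e ⟨a, ha⟩, (e ⟨a, ha⟩).2, ?_⟩
        have := hf (e ⟨a, ha⟩)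
        rw [e.symm_apply_apply] at this
        exact this.symm
      · rintro ⟨b, hb, rfl⟩
        have := hf ⟨b, hb⟩
        rw [LinearMap.mulLeft_apply]
        change _ = x * b at this
        rw [← this]
        exact (e.symm ⟨b, hb⟩).2
    · rintro ⟨x, hx, hA⟩
      have hIJ : I = Submodule.map (LinearMap.mulLeft R x) J := by
        apply le_antisymm
        · conv_lhs => rw [h1, hA, hS]
          refine Submodule.mul_le.2 ?_
          rintro _ ⟨s, hs, rfl⟩ b hb
          exact ⟨s * b, hs b hb, by simp [mul_assoc]⟩
        · rintro _ ⟨b, hb, rfl⟩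
          have : x ∈ colonSub I J := by
            rw [hA]
            exact ⟨1, fun y hy => by simpa using hy, by simp⟩
          exact this b hb
      have hinj : Function.Injective (LinearMap.mulLeft R x) := fun a b h =>
        hx.mul_left_cancel h
      exact ⟨(LinearEquiv.ofEq _ _ hIJ).trans (Submodule.equivMapOfInjective _ hinj J).symm⟩
end

section
/- Let f_1, …, f_r be distinct monic irreducible polynomials in ℤ[x], let e_1, …, e_r be positive integers, and set m = f_1⋯f_r, c = f_1^{e_1}⋯f_r^{e_r}, N = deg c. Let K_i = ℚ[x]/(f_i), let K = K_1^{e_1} × ⋯ × K_r^{e_r}, let Δ: ℚ[x]/(m) → K be the ℚ-algebra homomorphism that on the i-th group of factors is the diagonal embedding of K_i into K_i^{e_i}, let α = Δ(x mod m), and let R = Δ(ℤ[x]/(m)) = ℤ[α]. Let 𝓛(R,K) be the set of R-submodules of K that are finitely generated as ℤ-modules and span K over ℚ, and let 𝓜_{m,c}(ℤ) be the set of N×N integer matrices with minimal polynomial m and characteristic polynomial c. Then for every I ∈ 𝓛(R,K), multiplication by α is a ℤ-linear endomorphism of I whose matrix A(I,w̄) with respect to any ℤ-basis w̄ of I lies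 in 𝓜_{m,c}(ℤ), and the assignment I ↦ A(I,w̄) induces a well-defined bijection from the set of R-module isomorphism classes of elements of 𝓛(R,K) onto the set of GL_N(ℤ)-conjugacy classes of matrices in 𝓜_{m,c}(ℤ). -/
/-!
**Statement 18 (generalized Latimer–MacDuffee).**
Let `f 0, …, f (r-1)` be distinct monic irreducible polynomials in `ℤ[x]`, let
`e i ≥ 1`, and set `m = ∏ f i`, `c = ∏ (f i)^(e i)`, `N = deg c`.  Let
`K i = ℚ[x]/(f i)`, `K = ∏ i (K i)^(e i)`, let `α ∈ K` be the element whose every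
coordinate is the image of `x` (i.e. `α = Δ(x mod m)` for the diagonal embedding
`Δ : ℚ[x]/(m) → K`), and let `R = ℤ[α] = Δ(ℤ[x]/(m))`.  Let `𝓛(R,K)` be the set of
`R`-submodules of `K` finitely generated as `ℤ`-modules spanning `K` over `ℚ`, and
`𝓜_{m,c}(ℤ)` the set of `N×N` integer matrices with minimal polynomial `m` and
characteristic polynomial `c`.  Then for every `I ∈ 𝓛(R,K)` multiplication by `α`
preserves `I`, and its matrix with respect to any `ℤ`-basis `w` of `I` lies in
`𝓜_{m,c}(ℤ)`; the assignment `I ↦ A(I,w)` induces a well-defined bijection from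
`R`-isomorphism classes of elements of `𝓛(R,K)` onto `GL_N(ℤ)`-conjugacy classes of
matrices in `𝓜_{m,c}(ℤ)` (conjugacy is `IsConj`, conjugation by a unit of the matrix
ring, i.e. by an element of `GL_N(ℤ)`).
-/

open Polynomial Submodule

set_option synthInstance.maxHeartbeats 1000000
set_option maxHeartbeats 1000000

noncomputable section

/-- The `ℚ`-algebra `ℚ[x]/(g)` attached to an integral polynomial `g`. -/
abbrev QuotQ (g : Polynomial ℤ) : Type :=
  Polynomial ℚ ⧸ Ideal.span {g.map (algebraMap ℤ ℚ)}

variable (r : ℕ) (f : Fin r → Polynomial ℤ) (e : Fin r → ℕ)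

/-- `K = K_1^{e_1} × ⋯ × K_r^{e_r}` with `K_i = ℚ[x]/(f_i)`. -/
abbrev Kbig : Type := ∀ _p : (Σ i : Fin r, Fin (e i)), QuotQ (f _p.1)

/-- `α = Δ(x mod m)`: the image of `x` in every factor. -/
def αbig : Kbig r f e := fun _p => Ideal.Quotient.mk _ X

/-- `R = Δ(ℤ[x]/(m)) = ℤ[α]`. -/
def Rbig : Subalgebra ℤ (Kbig r f e) := Algebra.adjoin ℤ {αbig r f e}

/-- Membership in `𝓛(R,K)`: an `R`-submodule of `K`, finitely generated as a
`ℤ`-module, spanning `K` over `ℚ`. -/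
def IsLat (I : Submodule ↥(Rbig r f e) (Kbig r f e)) : Prop :=
  Module.Finite ℤ ↥I ∧ Submodule.span ℚ (I : Set (Kbig r f e)) = ⊤

/-- `w` is a `ℤ`-basis of the lattice `I`. -/
def IsZBasis {N : ℕ} (I : Submodule ↥(Rbig r f e) (Kbig r f e))
    (w : Fin N → Kbig r f e) : Prop :=
  LinearIndependent ℤ w ∧
    (Submodule.span ℤ (Set.range w) : Set (Kbig r f e)) = (I : Set (Kbig r f e))

/-- `A` is the matrix of multiplication by `α` with respect to `w`:
`α·w k = ∑ h, A k h • w h`. -/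
def Represents {N : ℕ} (w : Fin N → Kbig r f e) (A : Matrix (Fin N) (Fin N) ℤ) : Prop :=
  ∀ k, αbig r f e * w k = ∑ h, A k h • w h

/-- Membership in `𝓜_{m,c}(ℤ)`: minimal polynomial `m = ∏ f i` and characteristic
polynomial `c = ∏ (f i)^(e i)`. -/
def MemM {N : ℕ} (A : Matrix (Fin N) (Fin N) ℤ) : Prop :=
  minpoly ℤ A = ∏ i, f i ∧ A.charpoly = ∏ i, (f i) ^ (e i)

lemma charpoly_pi_aux (ι : Type) [Fintype ι] : ∀ (M : ι → Type) [∀ i, AddCommGroup (M i)]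
    [∀ i, Module ℚ (M i)] [∀ i, Module.Finite ℚ (M i)] (φ : ∀ i, M i →ₗ[ℚ] M i),
    (LinearMap.pi fun i => φ i ∘ₗ LinearMap.proj i).charpoly = ∏ i, (φ i).charpoly := by
  refine Fintype.induction_empty_option (P := fun ι _ => ∀ (M : ι → Type) [∀ i, AddCommGroup (M i)]
    [∀ i, Module ℚ (M i)] [∀ i, Module.Finite ℚ (M i)] (φ : ∀ i, M i →ₗ[ℚ] M i),
    (LinearMap.pi fun i => φ i ∘ₗ LinearMap.proj i).charpoly = ∏ i, (φ i).charpoly) ?_ ?_ ?_ ι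
  · intro α β _ g ih M _ _ _ φ
    let := Fintype.ofEquiv β g.symm
    have h := ih (fun i => M (g i)) (fun i => φ (g i))
    rw [← g.prod_comp, ← h]
    rw [← LinearEquiv.charpoly_conj (LinearEquiv.piCongrLeft ℚ M g)]
    congr 1
    apply LinearMap.ext
    intro x
    obtain ⟨y, rfl⟩ := (LinearEquiv.piCongrLeft ℚ M g).surjective x
    rw [LinearEquiv.conj_apply_apply, LinearEquiv.symm_apply_apply]
    funext b
    obtain ⟨a, rfl⟩ := g.surjective b
    have key : ∀ z, (LinearEquiv.piCongrLeft ℚ M g) z (g a) = z a := fun z =>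
      Equiv.piCongrLeft_apply_apply M g z a
    rw [key]
    simp [key]
  · intro M _ _ _ φ
    rw [Finset.univ_eq_empty, Finset.prod_empty]
    apply (Polynomial.Monic.natDegree_eq_zero (LinearMap.charpoly_monic _)).mp
    rw [LinearMap.charpoly_natDegree]
    exact Module.finrank_zero_of_subsingleton
  · intro α _ ih M _ _ _ φ
    rw [Fintype.prod_option, ← ih (fun i => M (some i)) (fun i => φ (some i)),
      ← LinearMap.charpoly_prodMap]
    let E : (∀ i, M i) ≃ₗ[ℚ] M none × (∀ i, M (some i)) :=
      { Equiv.piOptionEquivProd with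
        map_add' := fun _ _ => rfl
        map_smul' := fun _ _ => rfl }
    rw [← LinearEquiv.charpoly_conj E]
    congr 1

instance quotQ_finite (g : Polynomial ℤ) [hg : Fact g.Monic] : Module.Finite ℚ (QuotQ g) :=
  (AdjoinRoot.powerBasis (f := g.map (algebraMap ℤ ℚ)) (hg.out.map _).ne_zero).finite

lemma charpoly_quotQ (g : Polynomial ℤ) [hg : Fact g.Monic] :
    (LinearMap.mulLeft ℚ (Ideal.Quotient.mk _ X : QuotQ g)).charpoly
      = g.map (algebraMap ℤ ℚ) := by
  have hm : (g.map (algebraMap ℤ ℚ)).Monic := hg.out.map _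
  let pb := AdjoinRoot.powerBasis (f := g.map (algebraMap ℤ ℚ)) hm.ne_zero
  have h1 := charpoly_leftMulMatrix pb
  have h2 := AdjoinRoot.minpoly_powerBasis_gen_of_monic hm
  have h3 : pb.gen = AdjoinRoot.root _ := AdjoinRoot.powerBasis_gen _
  rw [h2] at h1
  rw [Algebra.leftMulMatrix_apply, h3] at h1
  refine Eq.trans ?_ h1
  have : Module.Finite ℚ (AdjoinRoot (g.map (algebraMap ℤ ℚ))) := pb.finite
  exact (LinearMap.charpoly_toMatrix (M := AdjoinRoot (g.map (algebraMap ℤ ℚ))) _ pb.basis).symm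

lemma charpoly_big [∀ i, Fact (f i).Monic] :
    (LinearMap.mulLeft ℚ (αbig r f e)).charpoly
      = (∏ i, (f i) ^ (e i)).map (algebraMap ℤ ℚ) := by
  have h := charpoly_pi_aux (Σ i : Fin r, Fin (e i)) (fun p => QuotQ (f p.1))
    (fun p => LinearMap.mulLeft ℚ (Ideal.Quotient.mk _ X : QuotQ (f p.1)))
  have h2 : (LinearMap.pi fun p : (Σ i : Fin r, Fin (e i)) =>
    LinearMap.mulLeft ℚ (Ideal.Quotient.mk _ X : QuotQ (f p.1)) ∘ₗ LinearMap.proj p)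
      = LinearMap.mulLeft ℚ (αbig r f e) := rfl
  rw [← h2, h]
  simp_rw [charpoly_quotQ]
  rw [Fintype.prod_sigma]
  simp [Polynomial.map_prod]

lemma finrank_big (hmonic : ∀ i, (f i).Monic) :
    Module.finrank ℚ (Kbig r f e) = (∏ i, (f i) ^ (e i)).natDegree := by
  have : ∀ i, Fact (f i).Monic := fun i => ⟨hmonic i⟩
  rw [← LinearMap.charpoly_natDegree (LinearMap.mulLeft ℚ (αbig r f e)),
    charpoly_big r f e]
  exact (monic_prod_of_monic _ _ fun i _ => (hmonic i).pow _).natDegree_map _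

lemma fQ_irr (hmonic : ∀ i, (f i).Monic) (hirr : ∀ i, Irreducible (f i)) (i : Fin r) :
    Irreducible ((f i).map (algebraMap ℤ ℚ)) :=
  (hmonic i).irreducible_iff_irreducible_map_fraction_map.mp (hirr i)

lemma fQ_coprime (hmonic : ∀ i, (f i).Monic) (hirr : ∀ i, Irreducible (f i))
    (hdist : Function.Injective f) {i j : Fin r} (hij : i ≠ j) :
    IsCoprime ((f i).map (algebraMap ℤ ℚ)) ((f j).map (algebraMap ℤ ℚ)) := by
  by_cases h : (f i).map (algebraMap ℤ ℚ) ∣ (f j).map (algebraMap ℤ ℚ)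
  · exfalso
    have := (fQ_irr r f hmonic hirr i).associated_of_dvd (fQ_irr r f hmonic hirr j) h
    have := eq_of_monic_of_associated ((hmonic i).map _) ((hmonic j).map _) this
    exact hij (hdist (map_injective _ (algebraMap ℤ ℚ).injective_int this))
  · exact (fQ_irr r f hmonic hirr i).coprime_iff_not_dvd.mpr h

lemma exp_le (hmonic : ∀ i, (f i).Monic) (hirr : ∀ i, Irreducible (f i))
    (hdist : Function.Injective f) (d : Fin r → ℕ)
    (h : (∏ i, (f i) ^ (d i)).map (algebraMap ℤ ℚ) = (∏ i, (f i) ^ (e i)).map (algebraMap ℤ ℚ))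
    (i : Fin r) : d i ≤ e i := by
  have hir := fQ_irr r f hmonic hirr i
  have h1 : ((f i).map (algebraMap ℤ ℚ)) ^ (d i) ∣
      ∏ j, ((f j).map (algebraMap ℤ ℚ)) ^ (e j) := by
    simp only [Polynomial.map_prod, Polynomial.map_pow] at h
    rw [← h]
    exact Finset.dvd_prod_of_mem (fun j => ((f j).map (algebraMap ℤ ℚ)) ^ (d j))
      (Finset.mem_univ i)
  rw [← Finset.mul_prod_erase _ _ (Finset.mem_univ i)] at h1
  have h2 : IsCoprime (((f i).map (algebraMap ℤ ℚ)) ^ (d i))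
      (∏ j ∈ Finset.univ.erase i, ((f j).map (algebraMap ℤ ℚ)) ^ (e j)) := by
    apply IsCoprime.prod_right
    intro j hj
    exact (fQ_coprime r f hmonic hirr hdist (Finset.ne_of_mem_erase hj).symm).pow
  exact (pow_dvd_pow_iff hir.ne_zero hir.not_isUnit).mp (h2.dvd_of_dvd_mul_right h1)

lemma aeval_big (q : Polynomial ℤ) (p : Σ i : Fin r, Fin (e i)) :
    (aeval (αbig r f e) q) p = Ideal.Quotient.mk _ (q.map (algebraMap ℤ ℚ)) := by
  induction q using Polynomial.induction_on' with
  | add a b ha hb => simp [ha, hb]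
  | monomial n a => simp [αbig, Pi.pow_apply, ← C_mul_X_pow_eq_monomial]

lemma aeval_big_eq_zero (hmonic : ∀ i, (f i).Monic) (hirr : ∀ i, Irreducible (f i))
    (hdist : Function.Injective f) (he : ∀ i, 0 < e i) (q : Polynomial ℤ) :
    aeval (αbig r f e) q = 0 ↔ (∏ i, f i) ∣ q := by
  have hm : (∏ i, f i).Monic := monic_prod_of_monic _ _ fun i _ => hmonic i
  constructor
  · intro h
    rw [← map_dvd_map (algebraMap ℤ ℚ) (algebraMap ℤ ℚ).injective_int hm, Polynomial.map_prod]
    apply Finset.prod_dvd_of_coprime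
    · intro i _ j _ hij
      exact fQ_coprime r f hmonic hirr hdist hij
    · intro i _
      have := congrFun h ⟨i, ⟨0, he i⟩⟩
      rw [aeval_big] at this
      exact Ideal.mem_span_singleton.mp (Ideal.Quotient.eq_zero_iff_mem.mp this)
  · intro h
    funext p
    rw [aeval_big]
    refine Ideal.Quotient.eq_zero_iff_mem.mpr (Ideal.mem_span_singleton.mpr ?_)
    exact Polynomial.map_dvd _ ((Finset.dvd_prod_of_mem f (Finset.mem_univ p.1)).trans h)

lemma abs_comb_mul {N : ℕ} {M : Type} [AddCommGroup M] (w : Fin N → M)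
    (P Q : Matrix (Fin N) (Fin N) ℤ) (k : Fin N) :
    ∑ j, P k j • ∑ l, Q j l • w l = ∑ l, (P * Q) k l • w l := by
  simp_rw [Matrix.mul_apply, Finset.sum_smul, Finset.smul_sum, mul_smul]
  rw [Finset.sum_comm]

lemma abs_rep_aeval {K : Type} [CommRing K] (α : K) {N : ℕ} (w : Fin N → K)
    (A : Matrix (Fin N) (Fin N) ℤ)
    (h : ∀ k, α * w k = ∑ h, A k h • w h) (q : Polynomial ℤ) (k : Fin N) :
    aeval α q * w k = ∑ j, (aeval A q) k j • w j := by
  induction q using Polynomial.induction_on generalizing k with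
  | C a =>
    rw [aeval_C, aeval_C, Algebra.algebraMap_eq_smul_one, Algebra.algebraMap_eq_smul_one]
    simp [Matrix.smul_apply, Matrix.one_apply]
  | add a b ha hb =>
    rw [map_add, map_add, add_mul, ha, hb, ← Finset.sum_add_distrib]
    simp_rw [Matrix.add_apply, add_smul]
  | monomial n a ih =>
    have h1 : (C a * X ^ (n + 1) : Polynomial ℤ) = C a * X ^ n * X := by ring
    rw [h1, map_mul, map_mul (aeval A), aeval_X, aeval_X, mul_assoc, h k, Finset.mul_sum]
    have hc : aeval A (C a * X ^ n) * A = A * aeval A (C a * X ^ n) := by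
      have := (Commute.all (X : Polynomial ℤ) (C a * X ^ n)).map (aeval A)
      rw [aeval_X] at this
      exact this.eq.symm
    rw [hc, ← abs_comb_mul]
    simp_rw [mul_smul_comm, ih]

lemma rep_aeval {N : ℕ} (w : Fin N → Kbig r f e) (A : Matrix (Fin N) (Fin N) ℤ)
    (h : Represents r f e w A) (q : Polynomial ℤ) (k : Fin N) :
    aeval (αbig r f e) q * w k = ∑ j, (aeval A q) k j • w j :=
  abs_rep_aeval (αbig r f e) w A h q k

lemma abs_comb_ext {N : ℕ} {M : Type} [AddCommGroup M] {w : Fin N → M}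
    (hw : LinearIndependent ℤ w) {P Q : Matrix (Fin N) (Fin N) ℤ}
    (h : ∀ k, ∑ j, P k j • w j = ∑ j, Q k j • w j) : P = Q := by
  ext k j
  have := Fintype.linearIndependent_iff.mp hw (fun j => P k j - Q k j)
    (by simp [sub_smul, h k]) j
  exact sub_eq_zero.mp this

lemma abs_iso {R : Type} [CommRing R] (a : R) (ha : Algebra.adjoin ℤ {a} = ⊤)
    {I J : Type} [AddCommGroup I] [AddCommGroup J] [Module R I] [Module R J] {N : ℕ}
    (bI : Module.Basis (Fin N) ℤ I) (bJ : Module.Basis (Fin N) ℤ J)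
    (A B : Matrix (Fin N) (Fin N) ℤ)
    (haI : ∀ k, a • bI k = ∑ j, A k j • bI j) (haJ : ∀ k, a • bJ k = ∑ j, B k j • bJ j) :
    Nonempty (I ≃ₗ[R] J) ↔ IsConj A B := by
  constructor
  · rintro ⟨φ⟩
    let P : Matrix (Fin N) (Fin N) ℤ := fun k j => bJ.repr (φ (bI k)) j
    let Q : Matrix (Fin N) (Fin N) ℤ := fun k j => bI.repr (φ.symm (bJ k)) j
    have hP : ∀ k, φ (bI k) = ∑ j, P k j • bJ j := fun k => (bJ.sum_repr _).symm
    have hQ : ∀ k, φ.symm (bJ k) = ∑ j, Q k j • bI j := fun k => (bI.sum_repr _).symm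
    have hPQ : P * Q = 1 := by
      apply abs_comb_ext bI.linearIndependent
      intro k
      rw [← abs_comb_mul]
      simp_rw [← hQ, ← map_zsmul, ← map_sum, ← hP]
      simp [Matrix.one_apply, ite_smul]
    have hQP : Q * P = 1 := by
      apply abs_comb_ext bJ.linearIndependent
      intro k
      rw [← abs_comb_mul]
      simp_rw [← hP, ← map_zsmul, ← map_sum, ← hQ]
      simp [Matrix.one_apply, ite_smul]
    refine ⟨⟨Q, P, hQP, hPQ⟩, ?_⟩
    change Q * A = B * Q
    apply abs_comb_ext bI.linearIndependent
    intro k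
    rw [← abs_comb_mul, ← abs_comb_mul]
    simp_rw [← hQ, ← map_zsmul, ← map_sum, ← haJ, map_smul, hQ, ← haI, Finset.smul_sum,
      smul_comm a]
  · rintro ⟨c, hc⟩
    have hc : c.val * A = B * c.val := hc
    let ψ : J ≃ₗ[ℤ] I := Matrix.toLinOfInv bJ bI
      (M := c.val.transpose) (M' := c.inv.transpose)
      (by rw [← Matrix.transpose_mul]; simp) (by rw [← Matrix.transpose_mul]; simp)
    have hψ : ∀ k, ψ (bJ k) = ∑ j, c.val k j • bI j := by
      intro k
      change Matrix.toLin bJ bI _ (bJ k) = _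
      rw [Matrix.toLin_self]
      rfl
    have hα : ∀ x, ψ (a • x) = a • ψ x := by
      intro x
      rw [← bJ.sum_repr x]
      simp_rw [Finset.smul_sum, map_sum, smul_comm a, map_zsmul, haJ, map_sum, Finset.smul_sum,
        smul_comm a, map_zsmul]
      apply Finset.sum_congr rfl
      intro k _
      rw [← Finset.smul_sum]
      congr 1
      simp_rw [hψ]
      rw [abs_comb_mul, ← hc, ← abs_comb_mul, Finset.smul_sum]
      simp_rw [← haI, smul_comm a]
    have hR : ∀ (y : R) (x : J), ψ (y • x) = y • ψ x := by
      intro y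
      have hy : y ∈ Algebra.adjoin ℤ {a} := by rw [ha]; trivial
      induction hy using Algebra.adjoin_induction with
      | mem y hy =>
        obtain rfl := hy
        exact hα
      | algebraMap n =>
        intro x
        rw [algebraMap_smul, algebraMap_smul, map_zsmul]
      | add y z hy hz ihy ihz =>
        intro x
        rw [add_smul, add_smul, map_add, ihy, ihz]
      | mul y z hy hz ihy ihz =>
        intro x
        rw [mul_smul, mul_smul, ihy, ihz]
    let Ψ : J ≃ₗ[R] I := { ψ with map_smul' := hR }
    exact ⟨Ψ.symm⟩

lemma mem_iff {N : ℕ} {I : Submodule ↥(Rbig r f e) (Kbig r f e)} {w : Fin N → Kbig r f e}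
    (hw : IsZBasis r f e I w) (x : Kbig r f e) :
    x ∈ I ↔ ∃ c : Fin N → ℤ, ∑ i, c i • w i = x := by
  rw [← Submodule.mem_span_range_iff_exists_fun]
  exact (Set.ext_iff.mp hw.2 x).symm

lemma w_mem {N : ℕ} {I : Submodule ↥(Rbig r f e) (Kbig r f e)} {w : Fin N → Kbig r f e}
    (hw : IsZBasis r f e I w) (k : Fin N) : w k ∈ I := by
  have : w k ∈ (I : Set (Kbig r f e)) := by
    rw [← hw.2]; exact Submodule.subset_span ⟨k, rfl⟩
  exact this

lemma alpha_mem : αbig r f e ∈ Rbig r f e := Algebra.subset_adjoin rfl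

lemma rep_exists {N : ℕ} {I : Submodule ↥(Rbig r f e) (Kbig r f e)} {w : Fin N → Kbig r f e}
    (hw : IsZBasis r f e I w) : ∃ A, Represents r f e w A := by
  have h : ∀ k, ∃ c : Fin N → ℤ, ∑ i, c i • w i = αbig r f e * w k := fun k =>
    (mem_iff r f e hw _).mp (I.smul_mem ⟨αbig r f e, alpha_mem r f e⟩ (w_mem r f e hw k))
  choose c hc using h
  exact ⟨Matrix.of c, fun k => (hc k).symm⟩

/-- `ℚ`-basis from a `ℤ`-basis of a lattice. -/
lemma exists_qbasis {N : ℕ} {I : Submodule ↥(Rbig r f e) (Kbig r f e)} (hI : IsLat r f e I)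
    {w : Fin N → Kbig r f e} (hw : IsZBasis r f e I w) :
    ∃ b : Module.Basis (Fin N) ℚ (Kbig r f e), ⇑b = w := by
  have h1 : LinearIndependent ℚ w := (LinearIndependent.iff_fractionRing ℤ ℚ).mp hw.1
  have h2 : ⊤ ≤ Submodule.span ℚ (Set.range w) := by
    rw [← hI.2, ← hw.2, Submodule.span_span_of_tower]
  exact ⟨Module.Basis.mk h1 h2, Module.Basis.coe_mk h1 h2⟩

lemma part1 (hmonic : ∀ i, (f i).Monic) (hirr : ∀ i, Irreducible (f i))
    (hdist : Function.Injective f) (he : ∀ i, 0 < e i) {N : ℕ}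
    {I : Submodule ↥(Rbig r f e) (Kbig r f e)} (hI : IsLat r f e I)
    {w : Fin N → Kbig r f e} (hw : IsZBasis r f e I w) (A : Matrix (Fin N) (Fin N) ℤ)
    (hA : Represents r f e w A) : MemM r f e A := by
  have : ∀ i, Fact (f i).Monic := fun i => ⟨hmonic i⟩
  obtain ⟨b, hb⟩ := exists_qbasis r f e hI hw
  have hm : (∏ i, f i).Monic := monic_prod_of_monic _ _ fun i _ => hmonic i
  have key : ∀ q : Polynomial ℤ, aeval A q = 0 ↔ aeval (αbig r f e) q = 0 := by
    intro q
    constructor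
    · intro h
      have h2 : LinearMap.mulLeft ℚ (aeval (αbig r f e) q) = 0 := by
        apply b.ext
        intro k
        rw [hb, LinearMap.mulLeft_apply, rep_aeval r f e w A hA, h]
        simp
      have h3 := LinearMap.congr_fun h2 1
      simpa using h3
    · intro h
      ext k j
      have h2 := rep_aeval r f e w A hA q k
      rw [h, zero_mul] at h2
      exact Fintype.linearIndependent_iff.mp hw.1 _ h2.symm j
  constructor
  · symm
    apply minpoly.unique' _ _ hm
    · rw [key, aeval_big_eq_zero r f e hmonic hirr hdist he]
    · intro q hq
      by_cases h0 : q = 0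
      · exact Or.inl h0
      · right
        rw [Ne, key, aeval_big_eq_zero r f e hmonic hirr hdist he]
        exact hm.not_dvd_of_degree_lt h0 hq
  · apply map_injective (algebraMap ℤ ℚ) (algebraMap ℤ ℚ).injective_int
    rw [← charpoly_big r f e, ← Matrix.charpoly_map, ← Matrix.charpoly_transpose,
      ← LinearMap.charpoly_toMatrix _ b]
    congr 1
    ext j k
    rw [LinearMap.toMatrix_apply, hb, LinearMap.mulLeft_apply, hA k, map_sum]
    have : ∀ h, A k h • w h = (A k h : ℚ) • b h := fun h => by
      rw [hb]; exact (Int.cast_smul_eq_zsmul ℚ (A k h) (w h)).symm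
    simp [this, Finsupp.single_apply]

lemma abs_zbasis {M L : Type} [AddCommGroup M] [AddCommGroup L] (ι : L →+ M)
    (hι : Function.Injective ι) {N : ℕ} (w : Fin N → L)
    (hw : LinearIndependent ℤ fun k => ι (w k))
    (hs : ∀ x : L, ∃ c : Fin N → ℤ, ∑ i, c i • ι (w i) = ι x) :
    ∃ b : Module.Basis (Fin N) ℤ L, ∀ k, b k = w k := by
  have h1 : LinearIndependent ℤ w :=
    LinearIndependent.of_comp ι.toIntLinearMap hw
  have h2 : ⊤ ≤ Submodule.span ℤ (Set.range w) := by
    rintro x -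
    rw [Submodule.mem_span_range_iff_exists_fun]
    obtain ⟨c, hc⟩ := hs x
    refine ⟨c, hι ?_⟩
    rw [← hc]
    simp
  exact ⟨Module.Basis.mk h1 h2, fun k => by rw [Module.Basis.mk_apply]⟩

section
variable {K : Type} [CommRing K] (α : K)

lemma gen_adjoin_top : Algebra.adjoin ℤ
    {(⟨α, Algebra.subset_adjoin rfl⟩ : Algebra.adjoin ℤ {α})} = ⊤ := by
  rw [← Algebra.adjoin_adjoin_coe_preimage (R := ℤ) (s := {α})]
  congr 1
  ext x
  exact Subtype.ext_iff

lemma gen_zbasis {I : Submodule ↥(Algebra.adjoin ℤ {α}) K} {N : ℕ} {w : Fin N → K}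
    (h1 : LinearIndependent ℤ w)
    (h2 : (Submodule.span ℤ (Set.range w) : Set K) = (I : Set K)) :
    ∃ b : Module.Basis (Fin N) ℤ ↥I, ∀ k, (b k : K) = w k := by
  have hm : ∀ k, w k ∈ I := fun k => by
    have : w k ∈ (I : Set K) := by
      rw [← h2]; exact Submodule.subset_span ⟨k, rfl⟩
    exact this
  obtain ⟨b, hb⟩ := abs_zbasis I.subtype.toAddMonoidHom Subtype.val_injective
    (fun k => ⟨w k, hm k⟩) h1 (fun x => by
      have hx : (x : K) ∈ (I : Set K) := x.2
      rw [← h2] at hx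
      exact (Submodule.mem_span_range_iff_exists_fun ℤ).mp hx)
  exact ⟨b, fun k => by rw [hb]⟩

lemma gen_part2 {I J : Submodule ↥(Algebra.adjoin ℤ {α}) K} {N : ℕ} {w v : Fin N → K}
    (hw1 : LinearIndependent ℤ w)
    (hw2 : (Submodule.span ℤ (Set.range w) : Set K) = (I : Set K))
    (hv1 : LinearIndependent ℤ v)
    (hv2 : (Submodule.span ℤ (Set.range v) : Set K) = (J : Set K))
    (A B : Matrix (Fin N) (Fin N) ℤ) (hA : ∀ k, α * w k = ∑ h, A k h • w h)
    (hB : ∀ k, α * v k = ∑ h, B k h • v h) :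
    Nonempty (↥I ≃ₗ[↥(Algebra.adjoin ℤ {α})] ↥J) ↔ IsConj A B := by
  obtain ⟨bI, hbI⟩ := gen_zbasis α hw1 hw2
  obtain ⟨bJ, hbJ⟩ := gen_zbasis α hv1 hv2
  refine abs_iso (⟨α, Algebra.subset_adjoin rfl⟩ : Algebra.adjoin ℤ {α})
    (gen_adjoin_top α) bI bJ A B ?_ ?_
  · intro k
    apply Subtype.ext
    have h := hA k
    simp_rw [← hbI] at h
    refine h.trans ?_
    exact (map_sum I.subtype.toAddMonoidHom (fun j => A k j • bI j) Finset.univ).symm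
  · intro k
    apply Subtype.ext
    have h := hB k
    simp_rw [← hbJ] at h
    refine h.trans ?_
    exact (map_sum J.subtype.toAddMonoidHom (fun j => B k j • bJ j) Finset.univ).symm

end

lemma part2 {N : ℕ} {I J : Submodule ↥(Rbig r f e) (Kbig r f e)}
    {w v : Fin N → Kbig r f e} (hw : IsZBasis r f e I w) (hv : IsZBasis r f e J v)
    (A B : Matrix (Fin N) (Fin N) ℤ) (hA : Represents r f e w A) (hB : Represents r f e v B) :
    Nonempty (↥I ≃ₗ[↥(Rbig r f e)] ↥J) ↔ IsConj A B :=
  gen_part2 (αbig r f e) hw.1 hw.2 hv.1 hv.2 A B hA hB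

lemma gen_sub {K : Type} [CommRing K] (α : K) {N : ℕ} (w : Fin N → K)
    (A : Matrix (Fin N) (Fin N) ℤ) (hA : ∀ k, α * w k = ∑ h, A k h • w h) :
    ∃ I : Submodule ↥(Algebra.adjoin ℤ {α}) K,
      (Submodule.span ℤ (Set.range w) : Set K) = (I : Set K) := by
  have key : ∀ y ∈ Algebra.adjoin ℤ {α}, ∀ x ∈ Submodule.span ℤ (Set.range w),
      y * x ∈ Submodule.span ℤ (Set.range w) := by
    intro y hy x hx
    rw [Algebra.adjoin_singleton_eq_range_aeval] at hy
    obtain ⟨q, rfl⟩ := hy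
    induction hx using Submodule.span_induction with
    | mem x hx =>
      obtain ⟨k, rfl⟩ := hx
      change aeval α q * w k ∈ _
      rw [abs_rep_aeval α w A hA q k]
      exact Submodule.sum_mem _ fun j _ =>
        Submodule.smul_mem _ _ (Submodule.subset_span ⟨j, rfl⟩)
    | zero => rw [mul_zero]; exact Submodule.zero_mem _
    | add a b _ _ ha hb => rw [mul_add]; exact Submodule.add_mem _ ha hb
    | smul n a _ ha => rw [mul_smul_comm]; exact Submodule.smul_mem _ _ ha
  exact ⟨{ carrier := Submodule.span ℤ (Set.range w)
           add_mem' := fun ha hb => Submodule.add_mem _ ha hb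
           zero_mem' := Submodule.zero_mem _
           smul_mem' := fun y x hx => key y.1 y.2 x hx }, rfl⟩

lemma gen_fin {K : Type} [CommRing K] (α : K) {N : ℕ} (w : Fin N → K)
    (I : Submodule ↥(Algebra.adjoin ℤ {α}) K) (hw : LinearIndependent ℤ w)
    (h : (Submodule.span ℤ (Set.range w) : Set K) = (I : Set K)) : Module.Finite ℤ ↥I := by
  obtain ⟨b, -⟩ := gen_zbasis α hw h
  exact Module.Finite.of_basis b

lemma torsion_equiv (V : Type) [AddCommGroup V] [Module ℚ[X] V] [Module.Finite ℚ[X] V]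
    (g : ℚ[X]) (hg : Irreducible g) :
    ∃ d : ℕ, Nonempty (Submodule.torsionBy ℚ[X] V g ≃ₗ[ℚ[X]]
      (Fin d → ℚ[X] ⧸ Ideal.span {g})) := by
  have : (Ideal.span {g}).IsMaximal := PrincipalIdealRing.isMaximal_of_irreducible hg
  let _ := Ideal.Quotient.field (Ideal.span {g})
  have : Module.Finite (ℚ[X] ⧸ Ideal.span {g}) (Submodule.torsionBy ℚ[X] V g) :=
    Module.Finite.of_restrictScalars_finite ℚ[X] _ _
  let b := Module.finBasis (ℚ[X] ⧸ Ideal.span {g}) (Submodule.torsionBy ℚ[X] V g)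
  exact ⟨_, ⟨b.equivFun.restrictScalars ℚ[X]⟩⟩

lemma struct_equiv (hmonic : ∀ i, (f i).Monic) (hirr : ∀ i, Irreducible (f i))
    (hdist : Function.Injective f)
    (V : Type) [AddCommGroup V] [Module ℚ[X] V] [Module.Finite ℚ[X] V]
    (hV : Module.IsTorsionBy ℚ[X] V (∏ i, (f i).map (algebraMap ℤ ℚ))) :
    ∃ d : Fin r → ℕ, Nonempty (V ≃ₗ[ℚ[X]] Kbig r f d) := by
  have hint := Submodule.torsionBy_isInternal (R := ℚ[X]) (M := V) (S := Finset.univ)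
    (q := fun i => (f i).map (algebraMap ℤ ℚ))
    (fun i _ j _ hij => fQ_coprime r f hmonic hirr hdist hij) hV
  choose d hd using fun i => torsion_equiv V _ (fQ_irr r f hmonic hirr i)
  let E1 := LinearEquiv.ofBijective (DirectSum.coeLinearMap _) hint
  let E2 := DirectSum.linearEquivFunOnFintype ℚ[X] (Finset.univ : Finset (Fin r))
    (fun i => Submodule.torsionBy ℚ[X] V ((f i).map (algebraMap ℤ ℚ)))
  let E3 := LinearEquiv.piCongrLeft ℚ[X]
    (fun i : Fin r => Submodule.torsionBy ℚ[X] V ((f i).map (algebraMap ℤ ℚ)))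
    (Equiv.subtypeUnivEquiv (p := fun i => i ∈ (Finset.univ : Finset (Fin r)))
      (fun i => Finset.mem_univ i))
  let E4 := LinearEquiv.piCongrRight fun i => (hd i).some
  let E5 : Kbig r f d ≃ₗ[ℚ[X]] (∀ i, Fin (d i) → QuotQ (f i)) :=
    LinearEquiv.piCurry ℚ[X] (fun (i : Fin r) (_ : Fin (d i)) => QuotQ (f i))
  exact ⟨d, ⟨E1.symm ≪≫ₗ E2 ≪≫ₗ E3 ≪≫ₗ E4 ≪≫ₗ E5.symm⟩⟩

lemma X_smul_big (d : Fin r → ℕ) (x : Kbig r f d) : (X : ℚ[X]) • x = αbig r f d * x := by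
  funext p
  obtain ⟨y, hy⟩ := Ideal.Quotient.mk_surjective (x p)
  rw [Pi.smul_apply, Pi.mul_apply, ← hy]
  rfl

lemma C_smul_big (d : Fin r → ℕ) (c : ℚ) (x : Kbig r f d) : (C c : ℚ[X]) • x = c • x := by
  funext p
  obtain ⟨y, hy⟩ := Ideal.Quotient.mk_surjective (x p)
  rw [Pi.smul_apply, Pi.smul_apply, ← hy]
  change Ideal.Quotient.mk _ (C c * y) = Ideal.Quotient.mk _ (c • y)
  rw [Polynomial.smul_eq_C_mul]

lemma end_equiv (hmonic : ∀ i, (f i).Monic) (hirr : ∀ i, Irreducible (f i))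
    (hdist : Function.Injective f) {N : ℕ} (T : (Fin N → ℚ) →ₗ[ℚ] (Fin N → ℚ))
    (hT : aeval T (∏ i, (f i).map (algebraMap ℤ ℚ)) = 0)
    (hc : T.charpoly = (∏ i, (f i) ^ (e i)).map (algebraMap ℤ ℚ)) :
    ∃ φ : (Fin N → ℚ) ≃ₗ[ℚ] Kbig r f e, ∀ x, φ (T x) = αbig r f e * φ x := by
  have hV : Module.IsTorsionBy ℚ[X] (Module.AEval' T) (∏ i, (f i).map (algebraMap ℤ ℚ)) := by
    intro x
    obtain ⟨y, rfl⟩ := (Module.AEval'.of T).surjective x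
    rw [← Module.AEval.of_aeval_smul, hT]
    simp
  have : Module.Finite ℚ[X] (Module.AEval' T) := inferInstance
  obtain ⟨d, ⟨Φ⟩⟩ := struct_equiv r f hmonic hirr hdist (Module.AEval' T) hV
  let φ : (Fin N → ℚ) ≃ₗ[ℚ] Kbig r f d :=
    { (Module.AEval'.of T).toEquiv.trans Φ.toEquiv with
      map_add' := fun x y => by
        change Φ (Module.AEval'.of T (x + y)) = Φ _ + Φ _
        rw [map_add, map_add]
        rfl
      map_smul' := fun c x => by
        change Φ (Module.AEval'.of T (c • x)) = c • Φ (Module.AEval'.of T x)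
        rw [← C_smul_big, ← map_smul, map_smul (Module.AEval'.of T), Module.AEval.C_smul] }
  have hφ : ∀ x, φ (T x) = αbig r f d * φ x := by
    intro x
    change Φ (Module.AEval'.of T (T x)) = αbig r f d * Φ (Module.AEval'.of T x)
    rw [← X_smul_big, ← map_smul, Module.AEval'.X_smul_of]
  have : ∀ i, Fact (f i).Monic := fun i => ⟨hmonic i⟩
  have hch : T.charpoly = (∏ i, (f i) ^ (d i)).map (algebraMap ℤ ℚ) := by
    rw [← charpoly_big r f d, ← LinearEquiv.charpoly_conj φ T]
    congr 1
    apply LinearMap.ext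
    intro x
    obtain ⟨y, rfl⟩ := φ.surjective x
    rw [LinearEquiv.conj_apply_apply, LinearEquiv.symm_apply_apply, hφ]
    rfl
  have hde : d = e := by
    funext i
    have h := hch.symm.trans hc
    exact le_antisymm (exp_le r f e hmonic hirr hdist d h i)
      (exp_le r f d hmonic hirr hdist e h.symm i)
  subst hde
  exact ⟨φ, hφ⟩

lemma aeval_transpose_aux {N : ℕ} (M : Matrix (Fin N) (Fin N) ℚ) (q : Polynomial ℤ) :
    aeval M.transpose q = (aeval M q).transpose := by
  induction q using Polynomial.induction_on' with
  | add a b ha hb => rw [map_add, map_add, ha, hb, Matrix.transpose_add]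
  | monomial n a =>
    rw [aeval_monomial, aeval_monomial, ← Algebra.smul_def, ← Algebra.smul_def,
      Matrix.transpose_smul, Matrix.transpose_pow]

lemma part3 (hmonic : ∀ i, (f i).Monic) (hirr : ∀ i, Irreducible (f i))
    (hdist : Function.Injective f) {N : ℕ} (A : Matrix (Fin N) (Fin N) ℤ)
    (hA : MemM r f e A) :
    ∃ (I : Submodule ↥(Rbig r f e) (Kbig r f e)) (w : Fin N → Kbig r f e),
        IsLat r f e I ∧ IsZBasis r f e I w ∧ Represents r f e w A := by
  let AQ : Matrix (Fin N) (Fin N) ℚ := (A.map (algebraMap ℤ ℚ)).transpose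
  have hT : aeval (Matrix.toLin' AQ) (∏ i, (f i).map (algebraMap ℤ ℚ)) = 0 := by
    have h0 : aeval A (∏ i, f i) = 0 := by rw [← hA.1]; exact minpoly.aeval ℤ A
    have h1 : aeval (A.map (algebraMap ℤ ℚ)) (∏ i, f i) = 0 := by
      have := congrArg (Algebra.ofId ℤ ℚ).mapMatrix h0
      rw [← aeval_algHom_apply, map_zero] at this
      exact this
    have h2 : aeval AQ (∏ i, f i) = 0 := by
      rw [aeval_transpose_aux, h1, Matrix.transpose_zero]
    rw [← Polynomial.map_prod, aeval_map_algebraMap]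
    have := congrArg (Matrix.toLinAlgEquiv' (R := ℚ) (n := Fin N)) h2
    have h3 := aeval_algHom_apply
      ((Matrix.toLinAlgEquiv' (R := ℚ) (n := Fin N)).restrictScalars ℤ).toAlgHom AQ (∏ i, f i)
    refine h3.trans (this.trans (map_zero _))
  have hc : (Matrix.toLin' AQ).charpoly = (∏ i, (f i) ^ (e i)).map (algebraMap ℤ ℚ) := by
    rw [Matrix.charpoly_toLin', Matrix.charpoly_transpose, Matrix.charpoly_map, hA.2]
  obtain ⟨φ, hφ⟩ := end_equiv r f e hmonic hirr hdist _ hT hc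
  let b := (Pi.basisFun ℚ (Fin N)).map φ
  let w : Fin N → Kbig r f e := fun k => φ (Pi.single k 1)
  have hbw : ⇑b = w := by funext k; simp [b, w]
  have hw1 : LinearIndependent ℤ w := by
    rw [← hbw]
    exact (LinearIndependent.iff_fractionRing ℤ ℚ).mpr b.linearIndependent
  have hrep : Represents r f e w A := by
    intro k
    have h1 : Matrix.toLin' AQ (Pi.single k 1) = ∑ h, A k h • (Pi.single h 1 : Fin N → ℚ) := by
      ext j
      simp [AQ, Matrix.toLin'_apply, Finset.sum_apply, Pi.single_apply]
    have h2 := hφ (Pi.single k 1)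
    rw [h1, map_sum] at h2
    refine h2.symm.trans ?_
    refine Finset.sum_congr rfl fun j _ => ?_
    exact map_zsmul φ (A k j) (Pi.single j 1)
  obtain ⟨I, hI⟩ := gen_sub (αbig r f e) w A hrep
  have hfin := gen_fin (αbig r f e) w I hw1 hI
  have hspan : Submodule.span ℚ (I : Set (Kbig r f e)) = ⊤ := by
    rw [← hI]
    refine (Submodule.span_span_of_tower ℤ ℚ (Set.range w)).trans ?_
    rw [← hbw]
    exact b.span_eq
  exact ⟨I, w, ⟨hfin, hspan⟩, ⟨hw1, hI⟩, hrep⟩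

theorem latimer_macduffee_generalization
    (hmonic : ∀ i, (f i).Monic) (hirr : ∀ i, Irreducible (f i))
    (hdist : Function.Injective f) (he : ∀ i, 0 < e i) :
    -- the matrix of multiplication by `α` with respect to any `ℤ`-basis of a lattice
    -- exists and lies in `𝓜_{m,c}(ℤ)`:
    (∀ I : Submodule ↥(Rbig r f e) (Kbig r f e), IsLat r f e I →
      ∀ w : Fin (∏ i, (f i) ^ (e i)).natDegree → Kbig r f e, IsZBasis r f e I w →
        (∃ A, Represents r f e w A) ∧ ∀ A, Represents r f e w A → MemM r f e A) ∧
    -- well-definedness and injectivity: two lattices are `R`-isomorphic iff their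
    -- matrices (w.r.t. any `ℤ`-bases) are `GL_N(ℤ)`-conjugate:
    (∀ I J : Submodule ↥(Rbig r f e) (Kbig r f e), IsLat r f e I → IsLat r f e J →
      ∀ w v : Fin (∏ i, (f i) ^ (e i)).natDegree → Kbig r f e,
        IsZBasis r f e I w → IsZBasis r f e J v →
      ∀ A B : Matrix (Fin (∏ i, (f i) ^ (e i)).natDegree)
          (Fin (∏ i, (f i) ^ (e i)).natDegree) ℤ,
        Represents r f e w A → Represents r f e v B →
        (Nonempty (↥I ≃ₗ[↥(Rbig r f e)] ↥J) ↔ IsConj A B)) ∧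
    -- surjectivity: every matrix in `𝓜_{m,c}(ℤ)` arises from a lattice:
    (∀ A : Matrix (Fin (∏ i, (f i) ^ (e i)).natDegree)
        (Fin (∏ i, (f i) ^ (e i)).natDegree) ℤ, MemM r f e A →
      ∃ (I : Submodule ↥(Rbig r f e) (Kbig r f e))
        (w : Fin (∏ i, (f i) ^ (e i)).natDegree → Kbig r f e),
        IsLat r f e I ∧ IsZBasis r f e I w ∧ Represents r f e w A) := by
  refine ⟨fun I hI w hw => ⟨rep_exists r f e hw,
      fun A hA => part1 r f e hmonic hirr hdist he hI hw A hA⟩,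
    fun I J _ _ w v hw hv A B hA hB => part2 r f e hw hv A B hA hB,
    fun A hA => part3 r f e hmonic hirr hdist A hA⟩

end
end

section
/- Let f ∈ ℤ[x] be a square-free monic polynomial of degree N and let R = ℤ[x]/(f), an order in the étale ℚ-algebra K = ℚ[x]/(f). Then there is a bijection between the set of GL_N(ℤ)-conjugacy classes of N×N integer matrices with characteristic polynomial f (equivalently, with minimal polynomial f and characteristic polynomial f) and the ideal class monoid ICM(R), the set of R-module isomorphism classes of fractional R-ideals. -/
/-!
**Statement 19 (Latimer–MacDuffee).**
Let `f ∈ ℤ[x]` be a squarefree monic polynomial of degree `N` (squarefree over `ℚ`,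
equivalently nonzero discriminant) and let `R = ℤ[x]/(f)`, realized as the monogenic
order `ℤ[α] ⊆ K = ℚ[x]/(f)` where `α` is the image of `x`.  Then there is a bijection
between the set of `GL_N(ℤ)`-conjugacy classes of `N×N` integer matrices with
characteristic polynomial `f` and the ideal class monoid `ICM(R)`: the set of
`R`-module isomorphism classes of fractional `R`-ideals.
-/

open Polynomial Submodule

set_option synthInstance.maxHeartbeats 1000000
set_option maxHeartbeats 1000000

noncomputable section

variable (f : Polynomial ℤ)

/-- `K = ℚ[x]/(f)`. -/
abbrev Kf : Type := Polynomial ℚ ⧸ Ideal.span {f.map (algebraMap ℤ ℚ)}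

/-- `α`, the image of `x` in `K`. -/
def αf : Kf f := Ideal.Quotient.mk _ X

/-- `R = ℤ[α] = ℤ[x]/(f)`. -/
def Rf : Subalgebra ℤ (Kf f) := Algebra.adjoin ℤ {αf f}

/-- Fractional `R`-ideals: finitely generated `R`-submodules of `K` spanning `K`
over `ℚ`. -/
def FracIdl : Type :=
  {I : Submodule ↥(Rf f) (Kf f) // I.FG ∧ Submodule.span ℚ (I : Set (Kf f)) = ⊤}

/-- `R`-module isomorphism of fractional ideals; the quotient is `ICM(R)`. -/
def isoSetoid : Setoid (FracIdl f) where
  r I J := Nonempty (↥I.1 ≃ₗ[↥(Rf f)] ↥J.1)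
  iseqv :=
    ⟨fun _ => ⟨LinearEquiv.refl _ _⟩, fun ⟨e⟩ => ⟨e.symm⟩, fun ⟨e⟩ ⟨e'⟩ => ⟨e.trans e'⟩⟩

/-- `N×N` integral matrices with characteristic polynomial `f` (equivalently, with
minimal polynomial `f` and characteristic polynomial `f`). -/
def MatCharpoly (N : ℕ) : Type :=
  {A : Matrix (Fin N) (Fin N) ℤ // A.charpoly = f}

/-- `GL_N(ℤ)`-conjugacy: `IsConj` in the matrix ring means conjugacy by a unit of
`Matrix (Fin N) (Fin N) ℤ`, i.e. by an element of `GL_N(ℤ)`. -/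
def conjSetoid (N : ℕ) : Setoid (MatCharpoly f N) where
  r A B := IsConj A.1 B.1
  iseqv := ⟨fun _ => IsConj.refl _, IsConj.symm, IsConj.trans⟩

/-- Squarefree charpoly divides the minimal polynomial. -/
theorem lm_charpoly_dvd_minpoly {N : ℕ} (B : Matrix (Fin N) (Fin N) ℚ)
    (hsq : Squarefree B.charpoly) : B.charpoly ∣ minpoly ℚ B := by
  let L := AlgebraicClosure ℚ
  have hsep : B.charpoly.Separable := PerfectField.separable_iff_squarefree.mpr hsq
  rw [← Polynomial.map_dvd_map' (algebraMap ℚ L)]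
  have hnd : ((B.charpoly).map (algebraMap ℚ L)).roots.Nodup :=
    nodup_roots (hsep.map)
  have hm0 : (minpoly ℚ B).map (algebraMap ℚ L) ≠ 0 :=
    (Polynomial.map_ne_zero_iff (algebraMap ℚ L).injective).mpr
      (minpoly.ne_zero (Algebra.IsIntegral.isIntegral B))
  have hc0 : (B.charpoly).map (algebraMap ℚ L) ≠ 0 :=
    (Polynomial.map_ne_zero_iff (algebraMap ℚ L).injective).mpr
      (Matrix.charpoly_monic B).ne_zero
  refine (IsAlgClosed.splits _).dvd_of_roots_le_roots hc0 ?_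
  rw [Multiset.le_iff_subset hnd]
  intro r hr
  rw [mem_roots hc0] at hr
  rw [mem_roots hm0]
  let BL : Matrix (Fin N) (Fin N) L := B.map (algebraMap ℚ L)
  have h1 : BL.charpoly = (B.charpoly).map (algebraMap ℚ L) :=
    Matrix.charpoly_map B (algebraMap ℚ L)
  rw [← h1] at hr
  have h2 := Matrix.mem_spectrum_of_isRoot_charpoly hr
  have h3 : aeval BL ((minpoly ℚ B).map (algebraMap ℚ L)) = 0 := by
    rw [aeval_map_algebraMap]
    have : BL = (Algebra.ofId ℚ L).mapMatrix B := rfl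
    rw [this, aeval_algHom_apply, minpoly.aeval, map_zero]
  have h4 := spectrum.subset_polynomial_aeval BL ((minpoly ℚ B).map (algebraMap ℚ L)) ⟨r, h2, rfl⟩
  rw [h3] at h4
  have h5 : Nontrivial (Matrix (Fin N) (Fin N) L) := by
    by_contra hcon
    rw [not_nontrivial_iff_subsingleton] at hcon
    simp [spectrum.of_subsingleton] at h4
  simpa [spectrum.zero_eq] using h4

theorem lm_aeval_alpha (f : Polynomial ℤ) (p : ℚ[X]) :
    aeval (αf f) p = Ideal.Quotient.mk (Ideal.span {f.map (algebraMap ℤ ℚ)}) p := by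
  have := Polynomial.aeval_algHom_apply (Ideal.Quotient.mkₐ ℚ (Ideal.span {f.map (algebraMap ℤ ℚ)})) X p
  rw [aeval_X_left_apply] at this
  exact this

theorem lm_finrank (f : Polynomial ℤ) (hmonic : f.Monic) :
    Module.Finite ℚ (Kf f) ∧ Module.finrank ℚ (Kf f) = f.natDegree := by
  let pb : PowerBasis ℚ (Kf f) := AdjoinRoot.powerBasis' (hmonic.map (algebraMap ℤ ℚ))
  refine ⟨pb.finite, ?_⟩
  rw [pb.finrank]
  exact hmonic.natDegree_map (algebraMap ℤ ℚ)

theorem lm_charpoly (f : Polynomial ℤ) (hmonic : f.Monic) :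
    haveI := (lm_finrank f hmonic).1
    (LinearMap.mulLeft ℚ (αf f)).charpoly = f.map (algebraMap ℤ ℚ) := by
  have := (lm_finrank f hmonic).1
  have hm := hmonic.map (algebraMap ℤ ℚ)
  let pb : PowerBasis ℚ (Kf f) := AdjoinRoot.powerBasis hm.ne_zero
  have h := charpoly_leftMulMatrix pb
  have h2 : minpoly ℚ pb.gen = f.map (algebraMap ℤ ℚ) :=
    AdjoinRoot.minpoly_powerBasis_gen_of_monic hm
  have h3 : pb.gen = αf f := rfl
  rw [h2, h3] at h
  exact (LinearMap.charpoly_toMatrix (LinearMap.mulLeft ℚ (αf f)) pb.basis).symm.trans h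

theorem lm_cyclic (f : Polynomial ℤ) (hmonic : f.Monic)
    (hsq : Squarefree (f.map (algebraMap ℤ ℚ)))
    (A : Matrix (Fin f.natDegree) (Fin f.natDegree) ℤ) (hA : A.charpoly = f) :
    ∃ ψ : Kf f ≃ₗ[ℚ] (Fin f.natDegree → ℚ),
      ∀ x, ψ (αf f * x) = (A.map (algebraMap ℤ ℚ)).mulVec (ψ x) := by
  have := (lm_finrank f hmonic).1
  set B := A.map (algebraMap ℤ ℚ) with hB
  have hBc : B.charpoly = f.map (algebraMap ℤ ℚ) := by
    rw [hB, Matrix.charpoly_map, hA]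
  have hdvd := lm_charpoly_dvd_minpoly B (hBc ▸ hsq)
  let T : Module.End ℚ (Fin f.natDegree → ℚ) := Matrix.toLin' B
  obtain ⟨v, hv⟩ := Module.exists_ker_toSpanSingleton_eq_annihilator ℚ[X] (Module.AEval' T)
  obtain ⟨v, rfl⟩ := (Module.AEval'.of T).surjective v
  rw [← Polynomial.span_minpoly_eq_annihilator] at hv
  have hTm : minpoly ℚ T = minpoly ℚ B := Matrix.minpoly_toLin' B
  let g : ℚ[X] →ₗ[ℚ] (Fin f.natDegree → ℚ) :=
    (LinearMap.applyₗ v) ∘ₗ (aeval T).toLinearMap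
  have hg : ∀ p, g p = aeval T p v := fun p => rfl
  have hker : ∀ p, g p = 0 ↔ minpoly ℚ T ∣ p := by
    intro p
    rw [← Ideal.mem_span_singleton, ← hv, LinearMap.mem_ker, LinearMap.toSpanSingleton_apply]
    rfl
  let I : Ideal ℚ[X] := Ideal.span {f.map (algebraMap ℤ ℚ)}
  have hann : aeval T (f.map (algebraMap ℤ ℚ)) = 0 := by
    rw [← hBc, ← minpoly.dvd_iff, hTm]
    exact Matrix.minpoly_dvd_charpoly B
  have hle : I.restrictScalars ℚ ≤ LinearMap.ker g := by
    intro p hp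
    have hp' : f.map (algebraMap ℤ ℚ) ∣ p := Ideal.mem_span_singleton.mp hp
    rw [LinearMap.mem_ker, hg]
    obtain ⟨q, rfl⟩ := hp'
    rw [map_mul, hann, zero_mul, LinearMap.zero_apply]
  let φ : Kf f →ₗ[ℚ] (Fin f.natDegree → ℚ) := Submodule.liftQ (I.restrictScalars ℚ) g hle
  have hφ : ∀ p, φ (Ideal.Quotient.mk I p) = aeval T p v := fun p => rfl
  have hinj : Function.Injective φ := by
    rw [injective_iff_map_eq_zero]
    intro x hx
    obtain ⟨p, rfl⟩ := Ideal.Quotient.mk_surjective x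
    rw [hφ, ← hg, hker, hTm] at hx
    rw [Ideal.Quotient.eq_zero_iff_mem, Ideal.mem_span_singleton, ← hBc]
    exact hdvd.trans hx
  refine ⟨LinearEquiv.ofInjectiveOfFinrankEq φ hinj ?_, ?_⟩
  · rw [(lm_finrank f hmonic).2]; simp
  · intro x
    obtain ⟨p, rfl⟩ := Ideal.Quotient.mk_surjective x
    change φ (Ideal.Quotient.mk I X * Ideal.Quotient.mk I p) = T (φ (Ideal.Quotient.mk I p))
    rw [← map_mul, hφ, hφ, map_mul, aeval_X]
    rfl

/-- `A` represents multiplication by `α` on `I`. -/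
def LMRel (f : Polynomial ℤ) (A : Matrix (Fin f.natDegree) (Fin f.natDegree) ℤ)
    (I : FracIdl f) : Prop :=
  ∃ e : (Fin f.natDegree → ℤ) ≃ₗ[ℤ] I.1, ∀ v, (e (A.mulVec v) : Kf f) = αf f * (e v : Kf f)

theorem lm_smul_mem (f : Polynomial ℤ) (S : Submodule ℤ (Kf f))
    (h : ∀ x ∈ S, αf f * x ∈ S) (r : Rf f) (x : Kf f) (hx : x ∈ S) : (r : Kf f) * x ∈ S := by
  obtain ⟨r, hr⟩ := r
  change r * x ∈ S
  induction hr using Algebra.adjoin_induction generalizing x with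
  | mem y hy => rw [Set.mem_singleton_iff.mp hy]; exact h x hx
  | algebraMap n =>
    rw [← Algebra.smul_def]; exact S.smul_mem n hx
  | add a b _ _ ha hb => rw [add_mul]; exact S.add_mem (ha x hx) (hb x hx)
  | mul a b _ _ ha hb => rw [mul_assoc]; exact ha _ (hb x hx)

theorem lm_exists_ideal (f : Polynomial ℤ) (hmonic : f.Monic)
    (hsq : Squarefree (f.map (algebraMap ℤ ℚ)))
    (A : Matrix (Fin f.natDegree) (Fin f.natDegree) ℤ) (hA : A.charpoly = f) :
    ∃ I, LMRel f A I := by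
  obtain ⟨ψ, hψ⟩ := lm_cyclic f hmonic hsq A hA
  let c : (Fin f.natDegree → ℤ) →ₗ[ℤ] (Fin f.natDegree → ℚ) :=
    (Algebra.linearMap ℤ ℚ).compLeft (Fin f.natDegree)
  have hc : ∀ w, c w = (algebraMap ℤ ℚ) ∘ w := fun w => rfl
  let e : (Fin f.natDegree → ℤ) →ₗ[ℤ] Kf f := (ψ.symm.toLinearMap.restrictScalars ℤ) ∘ₗ c
  have he : ∀ w, e w = ψ.symm ((algebraMap ℤ ℚ) ∘ w) := fun w => rfl
  have heA : ∀ w, e (A.mulVec w) = αf f * e w := by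
    intro w
    apply ψ.injective
    rw [hψ, he, he, LinearEquiv.apply_symm_apply, LinearEquiv.apply_symm_apply]
    ext i
    exact RingHom.map_mulVec (algebraMap ℤ ℚ) A w i
  have hinj : Function.Injective e := by
    intro a b hab
    have := ψ.symm.injective hab
    funext i
    have h := congrFun this i
    exact (algebraMap ℤ ℚ).injective_int h
  let I : Submodule (Rf f) (Kf f) :=
    { LinearMap.range e with
      smul_mem' := by
        intro r x hx
        refine lm_smul_mem f (LinearMap.range e) ?_ r x hx
        rintro _ ⟨w, rfl⟩
        exact ⟨_, heA w⟩ }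
  have hI : I.restrictScalars ℤ = LinearMap.range e := rfl
  have hfg : I.FG := by
    apply Submodule.FG.of_restrictScalars ℤ
    rw [hI]
    exact Module.Finite.iff_fg.mp (Module.Finite.range e)
  have hspan : Submodule.span ℚ (I : Set (Kf f)) = ⊤ := by
    rw [eq_top_iff]
    intro x _
    rw [← ψ.symm_apply_apply x, ← Finset.univ_sum_single (ψ x), map_sum]
    refine Submodule.sum_mem _ fun i _ => ?_
    have : Pi.single i (ψ x i) = (ψ x i) • ((algebraMap ℤ ℚ) ∘ (Pi.single i (1:ℤ)) : Fin f.natDegree → ℚ) := by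
      ext j
      by_cases h : j = i
      · subst h; simp
      · simp [h]
    rw [this, map_smul]
    exact Submodule.smul_mem _ _ (Submodule.subset_span ⟨_, he _⟩)
  refine ⟨⟨I, hfg, hspan⟩, LinearEquiv.ofInjective e hinj, heA⟩

theorem lm_integral (f : Polynomial ℤ) (hmonic : f.Monic) : IsIntegral ℤ (αf f) := by
  refine ⟨f, hmonic, ?_⟩
  have h := lm_aeval_alpha f (f.map (algebraMap ℤ ℚ))
  rw [aeval_map_algebraMap] at h
  rw [← aeval_def, h, Ideal.Quotient.eq_zero_iff_mem]
  exact Ideal.mem_span_singleton_self _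

theorem lm_alpha_mem (f : Polynomial ℤ) (I : Submodule (Rf f) (Kf f)) (x : Kf f) (hx : x ∈ I) :
    αf f * x ∈ I :=
  I.smul_mem (⟨αf f, Algebra.subset_adjoin rfl⟩ : Rf f) hx

theorem lm_exists_matrix (f : Polynomial ℤ) (hmonic : f.Monic) (I : FracIdl f) :
    ∃ A : MatCharpoly f f.natDegree, LMRel f A.1 I := by
  obtain ⟨I, hfg, hspan⟩ := I
  have := (lm_finrank f hmonic).1
  have hR : Module.Finite ℤ (Rf f) :=
    Algebra.finite_adjoin_simple_of_isIntegral (lm_integral f hmonic)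
  have : Module.Finite (Rf f) I := Module.Finite.of_fg hfg
  have hfinI : Module.Finite ℤ I := Module.Finite.trans (Rf f) I
  have : Module.IsTorsionFree ℤ (Kf f) := Module.IsTorsionFree.trans_faithfulSMul ℤ ℚ _
  have : Module.Free ℤ I := inferInstance
  let b := Module.Free.chooseBasis ℤ I
  have hli : LinearIndependent ℤ (fun i => (b i : Kf f)) :=
    b.linearIndependent.map' (I.subtype.restrictScalars ℤ) (LinearMap.ker_eq_bot.mpr Subtype.val_injective)
  have hliQ : LinearIndependent ℚ (fun i => (b i : Kf f)) :=
    (LinearIndependent.iff_fractionRing ℤ ℚ).mp hli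
  have hsp : ⊤ ≤ Submodule.span ℚ (Set.range fun i => (b i : Kf f)) := by
    rw [← hspan, Submodule.span_le]
    intro x hx
    have h := b.sum_repr ⟨x, hx⟩
    have h' := congrArg (fun y : I => (y : Kf f)) h
    simp only [AddSubmonoidClass.coe_finsetSum] at h'
    rw [← h']
    refine Submodule.sum_mem _ fun i _ => ?_
    have h0 : (b i : Kf f) ∈ Submodule.span ℚ (Set.range fun i => (b i : Kf f)) :=
      Submodule.subset_span ⟨i, rfl⟩
    exact zsmul_mem h0 (b.repr ⟨x, hx⟩ i)
  let bQ := Module.Basis.mk hliQ hsp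
  have hcard : Fintype.card (Module.Free.ChooseBasisIndex ℤ I) = f.natDegree := by
    rw [← (lm_finrank f hmonic).2, Module.finrank_eq_card_basis bQ]
  let σ := Fintype.equivFinOfCardEq hcard
  let b' := b.reindex σ
  let bQ' := bQ.reindex σ
  have hbb : ∀ i, bQ' i = (b' i : Kf f) := by
    intro i; simp [bQ', b', bQ]
  let e : (Fin f.natDegree → ℤ) ≃ₗ[ℤ] I := b'.equivFun.symm
  let m : I →ₗ[ℤ] I := 
    { toFun := fun x => ⟨αf f * x, lm_alpha_mem f I x x.2⟩
      map_add' := by intro x y; ext; exact mul_add _ _ _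
      map_smul' := by intro n x; ext; exact mul_smul_comm n _ _ }
  have hA : ((LinearMap.toMatrix b' b' m)).map (algebraMap ℤ ℚ) =
      LinearMap.toMatrix bQ' bQ' (LinearMap.mulLeft ℚ (αf f)) := by
    ext i j
    rw [LinearMap.toMatrix_apply, Matrix.map_apply, LinearMap.toMatrix_apply, hbb,
      LinearMap.mulLeft_apply]
    have h := congrArg (fun y : I => (y : Kf f)) (b'.sum_repr (m (b' j)))
    simp only [AddSubmonoidClass.coe_finsetSum] at h
    have h2 : αf f * (b' j : Kf f) = ∑ k, ((algebraMap ℤ ℚ) (b'.repr (m (b' j)) k)) • bQ' k := by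
      refine h.symm.trans (Finset.sum_congr rfl fun k _ => ?_)
      rw [hbb, algebraMap_smul]
      rfl
    rw [h2, bQ'.repr_sum_self]
  refine ⟨⟨LinearMap.toMatrix b' b' m, ?_⟩, e, ?_⟩
  · apply Polynomial.map_injective (algebraMap ℤ ℚ) (algebraMap ℤ ℚ).injective_int
    rw [← Matrix.charpoly_map, hA, LinearMap.charpoly_toMatrix, lm_charpoly f hmonic]
  · intro v
    have : e ((LinearMap.toMatrix b' b' m).mulVec v) = m (e v) := by
      apply b'.equivFun.injective
      have h := LinearMap.toMatrix_mulVec_repr b' b' m (e v)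
      rw [LinearEquiv.apply_symm_apply]
      have h3 : ⇑(b'.repr (e v)) = v := b'.equivFun.apply_symm_apply v
      rw [h3] at h
      exact h
    rw [this]
    rfl

theorem lm_iff (f : Polynomial ℤ) (A B : Matrix (Fin f.natDegree) (Fin f.natDegree) ℤ)
    (I J : FracIdl f) (hA : LMRel f A I) (hB : LMRel f B J) :
    IsConj A B ↔ Nonempty (I.1 ≃ₗ[Rf f] J.1) := by
  obtain ⟨a, ha⟩ := hA
  obtain ⟨b, hb⟩ := hB
  constructor
  · rintro ⟨u, hu⟩
    have hu' : (u : Matrix _ _ ℤ) * A = B * (u : Matrix _ _ ℤ) := hu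
    let P : (Fin f.natDegree → ℤ) ≃ₗ[ℤ] (Fin f.natDegree → ℤ) :=
      Matrix.toLin'OfInv u.inv_mul u.mul_inv
    have hP : ∀ v, P v = (u : Matrix _ _ ℤ).mulVec v := fun v => Matrix.toLin'_apply _ _
    let E : I.1 ≃ₗ[ℤ] J.1 := a.symm ≪≫ₗ P ≪≫ₗ b
    have hE : ∀ x y : I.1, (y : Kf f) = αf f * x → (E y : Kf f) = αf f * E x := by
      intro x y hxy
      obtain ⟨w, rfl⟩ := a.surjective x
      have hy : y = a (A.mulVec w) := Subtype.ext (hxy.trans (ha w).symm)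
      subst hy
      simp only [E, LinearEquiv.trans_apply, LinearEquiv.symm_apply_apply, hP]
      rw [Matrix.mulVec_mulVec, hu', ← Matrix.mulVec_mulVec, hb]
    have hlin : ∀ (r : Rf f) (x : I.1), E (r • x) = r • E x := by
      rintro ⟨r, hr⟩
      induction hr using Algebra.adjoin_induction with
      | mem y hy =>
        intro x
        obtain rfl := Set.mem_singleton_iff.mp hy
        exact Subtype.ext (hE x _ rfl)
      | algebraMap n =>
        intro x
        have h1 : ∀ (K : Submodule (Rf f) (Kf f)) (z : K),
            (⟨algebraMap ℤ (Kf f) n, Subalgebra.algebraMap_mem _ n⟩ : Rf f) • z = n • z :=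
          fun K z => algebraMap_smul (Rf f) n z
        exact (congrArg E (h1 _ x)).trans ((map_smul E n x).trans (h1 _ (E x)).symm)
      | add p q hp hq ihp ihq =>
        intro x
        have h1 : ∀ (K : Submodule (Rf f) (Kf f)) (z : K),
            (⟨p + q, Subalgebra.add_mem _ hp hq⟩ : Rf f) • z =
              (⟨p, hp⟩ : Rf f) • z + (⟨q, hq⟩ : Rf f) • z :=
          fun K z => add_smul (⟨p, hp⟩ : Rf f) ⟨q, hq⟩ z
        exact (congrArg E (h1 _ x)).trans ((map_add E _ _).trans
          ((congrArg₂ (· + ·) (ihp x) (ihq x)).trans (h1 _ (E x)).symm))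
      | mul p q hp hq ihp ihq =>
        intro x
        have h1 : ∀ (K : Submodule (Rf f) (Kf f)) (z : K),
            (⟨p * q, Subalgebra.mul_mem _ hp hq⟩ : Rf f) • z =
              (⟨p, hp⟩ : Rf f) • (⟨q, hq⟩ : Rf f) • z :=
          fun K z => mul_smul (⟨p, hp⟩ : Rf f) ⟨q, hq⟩ z
        exact (congrArg E (h1 _ x)).trans ((ihp _).trans
          ((congrArg _ (ihq x)).trans (h1 _ (E x)).symm))
    exact ⟨{ E with map_smul' := hlin }⟩
  · rintro ⟨E⟩
    have hEα : ∀ x y : I.1, (y : Kf f) = αf f * x → (E y : Kf f) = αf f * E x := by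
      intro x y hxy
      have hy : y = (⟨αf f, Algebra.subset_adjoin rfl⟩ : Rf f) • x := Subtype.ext hxy
      rw [hy, map_smul]
      rfl
    let P : (Fin f.natDegree → ℤ) ≃ₗ[ℤ] (Fin f.natDegree → ℤ) :=
      a ≪≫ₗ (E.restrictScalars ℤ) ≪≫ₗ b.symm
    have hP : ∀ v, b (P v) = E (a v) := fun v => b.apply_symm_apply _
    have h1 : LinearMap.toMatrix' P.toLinearMap * LinearMap.toMatrix' P.symm.toLinearMap = 1 := by
      rw [← LinearMap.toMatrix'_comp]; simp
    have h2 : LinearMap.toMatrix' P.symm.toLinearMap * LinearMap.toMatrix' P.toLinearMap = 1 := by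
      rw [← LinearMap.toMatrix'_comp]; simp
    refine ⟨⟨_, _, h1, h2⟩, ?_⟩
    change LinearMap.toMatrix' P.toLinearMap * A = B * LinearMap.toMatrix' P.toLinearMap
    apply Matrix.toLin'.injective
    refine LinearMap.ext fun v => ?_
    rw [Matrix.toLin'_mul, Matrix.toLin'_mul, Matrix.toLin'_toMatrix']
    change P (A.mulVec v) = B.mulVec (P v)
    apply b.injective
    apply Subtype.ext
    rw [hP, hb, hP]
    exact hEα _ _ (ha v)

theorem latimer_macduffee
    (hmonic : f.Monic) (hsq : Squarefree (f.map (algebraMap ℤ ℚ))) :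
    Nonempty (Quotient (conjSetoid f f.natDegree) ≃ Quotient (isoSetoid f)) := by
  choose M hM using lm_exists_matrix f hmonic
  refine ⟨(Equiv.ofBijective (Quotient.lift (s := isoSetoid f)
    (fun I => Quotient.mk (conjSetoid f f.natDegree) (M I)) ?_) ⟨?_, ?_⟩).symm⟩
  · intro I J h
    exact Quotient.sound ((lm_iff f _ _ I J (hM I) (hM J)).mpr h)
  · intro x y
    induction x using Quotient.inductionOn
    induction y using Quotient.inductionOn
    intro h
    exact Quotient.sound ((lm_iff f _ _ _ _ (hM _) (hM _)).mp (Quotient.exact h))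
  · intro y
    induction y using Quotient.inductionOn with | _ A
    obtain ⟨I, hI⟩ := lm_exists_ideal f hmonic hsq A.1 A.2
    refine ⟨Quotient.mk _ I, Quotient.sound ?_⟩
    exact (lm_iff f _ _ I I (hM I) hI).mpr ⟨LinearEquiv.refl _ _⟩

end
end
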